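/- arXiv:1503.03780 — 6 statements merged into one kernel-verified Lean document; each statement's English description precedes it below -/
import Mathlib

section
/- Let k be a field of characteristic zero containing a primitive third root of unity. Let G be a finite subgroup of SL_2(ℤ), acting on F = k(x,y) by Poisson monomial automorphisms: for g = [[a,b],[c,d]] ∈ SL_2(ℤ), σ_g is the k-algebra automorphism of F with σ_g(y) = y^a x^c and σ_g(x) = y^b x^d. Then the fixed field F^G is Poisson-isomorphic to F, i.e. there exists a k-algebra isomorphism F^G → F that respects the Poisson brackets. -/
noncomputable section

/-- A Poisson bracket on a commutative `k`-algebra `R`: a `k`-bilinear antisymmetric map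
satisfying the Jacobi identity and the Leibniz rule in each argument. -/
structure PoissonBracket (k R : Type*) [CommRing k] [CommRing R] [Algebra k R] where
  bracket : R →ₗ[k] R →ₗ[k] R
  antisymm : ∀ a b : R, bracket a b = - bracket b a
  jacobi : ∀ a b c : R,
    bracket a (bracket b c) + bracket b (bracket c a) + bracket c (bracket a b) = 0
  leibniz : ∀ a b c : R, bracket a (b * c) = bracket a b * c + b * bracket a c

/-- The subalgebra of elements fixed by a family of algebra automorphisms. -/
def fixedSubalgebra {k F : Type*} [CommSemiring k] [CommSemiring F] [Algebra k F]
    {G : Type*} (σ : G → F ≃ₐ[k] F) : Subalgebra k F where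
  carrier := {a | ∀ g : G, σ g a = a}
  mul_mem' := fun {a b} ha hb g => by rw [map_mul, ha g, hb g]
  add_mem' := fun {a b} ha hb g => by rw [map_add, ha g, hb g]
  one_mem' := fun g => map_one (σ g)
  zero_mem' := fun g => map_zero (σ g)
  algebraMap_mem' := fun r g => (σ g).commutes r

namespace PoissonBracket

section Ring

variable {k R : Type*} [CommRing k] [CommRing R] [Algebra k R] (P : PoissonBracket k R)

/-- The Hamiltonian derivation `{a, ·}`. -/
def ham (a : R) : Derivation k R R :=
  Derivation.mk' (P.bracket a) fun b c => by
    rw [P.leibniz, smul_eq_mul, smul_eq_mul, mul_comm (P.bracket a b), add_comm]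

theorem ham_apply (a b : R) : P.ham a b = P.bracket a b := rfl

theorem bracket_mul_left (a b c : R) :
    P.bracket (a * b) c = a * P.bracket b c + b * P.bracket a c := by
  rw [P.antisymm, P.leibniz, P.antisymm c a, P.antisymm c b]
  ring

theorem bracket_pow_right (a b : R) (n : ℕ) :
    P.bracket a (b ^ n) = n * b ^ (n - 1) * P.bracket a b := by
  simp only [← ham_apply, Derivation.leibniz_pow, nsmul_eq_mul, smul_eq_mul, mul_assoc]

theorem bracket_algebraMap_right (a : R) (c : k) : P.bracket a (algebraMap k R c) = 0 :=
  (P.ham a).map_algebraMap c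

theorem bracket_algebraMap_left (a : R) (c : k) : P.bracket (algebraMap k R c) a = 0 := by
  rw [P.antisymm, P.bracket_algebraMap_right, neg_zero]

theorem bracket_one_right (a : R) : P.bracket a 1 = 0 :=
  (P.ham a).map_one_eq_zero

theorem bracket_one_left (a : R) : P.bracket 1 a = 0 := by
  rw [P.antisymm, P.bracket_one_right, neg_zero]

theorem bracket_natCast_right (a : R) (n : ℕ) : P.bracket a n = 0 :=
  (P.ham a).map_natCast n

theorem bracket_natCast_left (a : R) (n : ℕ) : P.bracket n a = 0 := by
  rw [P.antisymm, P.bracket_natCast_right, neg_zero]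

theorem bracket_ofNat_left (a : R) (n : ℕ) [n.AtLeastTwo] :
    P.bracket (OfNat.ofNat n : R) a = 0 :=
  P.bracket_natCast_left a n

end Ring

variable {k F : Type*} [Field k] [Field F] [Algebra k F] (P : PoissonBracket k F)

theorem bracket_self [CharZero k] (a : F) : P.bracket a a = 0 := by
  have : CharZero F := charZero_of_injective_algebraMap (algebraMap k F).injective
  exact self_eq_neg.mp (P.antisymm a a)

theorem bracket_inv_right (a b : F) : P.bracket a b⁻¹ = -(P.bracket a b) / b ^ 2 := by
  rw [← ham_apply, Derivation.leibniz_inv, ham_apply, smul_eq_mul, inv_pow]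
  ring

theorem bracket_inv_left (a b : F) : P.bracket a⁻¹ b = -(P.bracket a b) / a ^ 2 := by
  rw [P.antisymm, P.bracket_inv_right, P.antisymm b a]
  ring

theorem bracket_div_right (a b c : F) :
    P.bracket a (b / c) = P.bracket a b / c - b * P.bracket a c / c ^ 2 := by
  rw [div_eq_mul_inv, P.leibniz, P.bracket_inv_right]
  ring

theorem bracket_div_left (a b c : F) :
    P.bracket (a / b) c = P.bracket a c / b - a * P.bracket b c / b ^ 2 := by
  rw [P.antisymm, P.bracket_div_right, P.antisymm c a, P.antisymm c b]
  ring

theorem bracket_zpow_right (a b : F) (n : ℤ) :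
    P.bracket a (b ^ n) = n * b ^ (n - 1) * P.bracket a b := by
  simp only [← ham_apply, Derivation.leibniz_zpow, zsmul_eq_mul, smul_eq_mul, mul_assoc]

/-- If `{y, x} = yx`, then the bracket of two Laurent monomials is given by a determinant. -/
theorem bracket_monomial [CharZero k] {x y : F} (hx : x ≠ 0) (hy : y ≠ 0)
    (h : P.bracket y x = y * x) (a b c d : ℤ) :
    P.bracket (y ^ a * x ^ c) (y ^ b * x ^ d) =
      (a * d - b * c : ℤ) * ((y ^ a * x ^ c) * (y ^ b * x ^ d)) := by
  have h' : P.bracket x y = -(y * x) := by rw [P.antisymm, h]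
  have e1 : P.bracket y (y ^ b * x ^ d) = d * y * (y ^ b * x ^ d) := by
    rw [P.leibniz, P.bracket_zpow_right, P.bracket_zpow_right, P.bracket_self, h, zpow_sub_one₀ hx]
    field_simp
    ring
  have e2 : P.bracket x (y ^ b * x ^ d) = -b * x * (y ^ b * x ^ d) := by
    rw [P.leibniz, P.bracket_zpow_right, P.bracket_zpow_right, P.bracket_self, h', zpow_sub_one₀ hy]
    field_simp
    ring
  rw [P.antisymm, P.leibniz, P.bracket_zpow_right, P.bracket_zpow_right, P.antisymm _ y,
    P.antisymm _ x, e1, e2, zpow_sub_one₀ hx, zpow_sub_one₀ hy]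
  push_cast
  field_simp
  ring

/-- The elements Poisson-commuting with `a`. -/
def centralizer (a : F) : IntermediateField k F where
  carrier := {b | P.bracket a b = 0}
  mul_mem' := fun {b c} hb hc => by
    change P.bracket a (b * c) = 0
    rw [P.leibniz, show P.bracket a b = 0 from hb, show P.bracket a c = 0 from hc, zero_mul,
      mul_zero, add_zero]
  add_mem' := fun {b c} hb hc => by
    change P.bracket a (b + c) = 0
    rw [map_add, show P.bracket a b = 0 from hb, show P.bracket a c = 0 from hc, add_zero]
  algebraMap_mem' := fun r => P.bracket_algebraMap_right a r
  inv_mem' := fun b hb => by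
    change P.bracket a b⁻¹ = 0
    rw [P.bracket_inv_right, show P.bracket a b = 0 from hb, neg_zero, zero_div]

theorem mem_centralizer {a b : F} : b ∈ P.centralizer a ↔ P.bracket a b = 0 := Iff.rfl

theorem mem_centralizer_of_isAlgebraic [CharZero k] {a b : F}
    (h : IsAlgebraic (P.centralizer a) b) : b ∈ P.centralizer a := by
  let D : Derivation (P.centralizer a) F F := Derivation.mk'
    { toFun := P.bracket a
      map_add' := map_add _
      map_smul' := fun c b => by
        rw [Algebra.smul_def, P.leibniz]
        have hc : P.bracket a (algebraMap (P.centralizer a) F c) = 0 := c.2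
        rw [hc, zero_mul, zero_add, RingHom.id_apply, Algebra.smul_def] }
    fun b c => by
      simp only [LinearMap.coe_mk, AddHom.coe_mk]
      rw [P.leibniz, smul_eq_mul, smul_eq_mul, mul_comm (P.bracket a b), add_comm]
  have hD : D b = P.bracket a b := rfl
  have : CharZero (P.centralizer a) :=
    charZero_of_injective_algebraMap (algebraMap k (P.centralizer a)).injective
  have h1 := D.map_aeval (minpoly (P.centralizer a) b) b
  rw [minpoly.aeval, map_zero, smul_eq_mul, hD] at h1
  refine (mul_eq_zero.mp h1.symm).resolve_left ?_
  exact (minpoly.irreducible h.isIntegral).separable.aeval_derivative_ne_zero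
    (minpoly.aeval _ _)

/-- Two elements with nonzero Poisson bracket are algebraically independent. -/
theorem algebraicIndependent [CharZero k] {x y : F} (h : P.bracket y x ≠ 0) :
    AlgebraicIndependent k ![x, y] := by
  have hy : Transcendental k y := fun hy => h <| by
    rw [P.antisymm, (P.mem_centralizer (a := x)).1
      (P.mem_centralizer_of_isAlgebraic (hy.extendScalars
        (algebraMap k (P.centralizer x)).injective)), neg_zero]
  have hx : Transcendental (P.centralizer y).toSubalgebra x := fun hx =>
    h (P.mem_centralizer_of_isAlgebraic hx)
  rw [AlgebraicIndependent.iff_transcendental_adjoin_image 0]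
  constructor
  · have : Subsingleton {j : Fin 2 // j ≠ 0} := ⟨fun a b => by
      ext; have := a.2; have := b.2; omega⟩
    exact (algebraicIndependent_singleton_iff (⟨1, one_ne_zero⟩ : {j : Fin 2 // j ≠ 0})).2 hy
  · refine Transcendental.of_tower_top_of_subalgebra_le (Algebra.adjoin_le ?_) hx
    rintro _ ⟨j, hj, rfl⟩
    obtain rfl : j = 1 := Fin.eq_one_of_ne_zero j hj
    exact P.bracket_self y

end PoissonBracket

/-- A polynomial which does not vanish at some point does not vanish at a pair of algebraically
independent elements. -/
theorem AlgebraicIndependent.aeval_pair_ne_zero {k F : Type*} [CommRing k]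
    [CommRing F] [Algebra k F] {x y : F} (hx : AlgebraicIndependent k ![x, y])
    (p : MvPolynomial (Fin 2) k) (a b : k) (h : MvPolynomial.eval ![a, b] p ≠ 0) :
    MvPolynomial.aeval ![x, y] p ≠ 0 := fun h0 =>
  h <| by rw [hx.eq_zero_of_aeval_eq_zero p h0, map_zero]

section Descent

variable {k F : Type*} [Field k] [Field F] [Algebra k F]

/-- Two algebra homomorphisms which agree on `s` agree on the field generated by `s`. -/
theorem eq_of_mem_adjoin {F' : Type*} [Field F'] [Algebra k F'] {f g : F →ₐ[k] F'} {s : Set F}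
    (h : ∀ a ∈ s, f a = g a) {a : F} (ha : a ∈ IntermediateField.adjoin k s) : f a = g a := by
  induction ha using IntermediateField.adjoin_induction with
  | mem a ha => exact h a ha
  | algebraMap r => rw [f.commutes, g.commutes]
  | add a b _ _ ha hb => rw [map_add, map_add, ha, hb]
  | inv a _ ha => rw [map_inv₀, map_inv₀, ha]
  | mul a b _ _ ha hb => rw [map_mul, map_mul, ha, hb]

/-- Kummer descent: if an automorphism `θ` fixes `s` and acts on `z` by a primitive `n`-th root of
unity, with `zⁿ ∈ k(s)`, then the elements of `k(s, z)` fixed by `θ` lie in `k(s)`. -/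
theorem mem_adjoin_of_fixed [CharZero k] {θ : F ≃ₐ[k] F} {s : Set F} (hs : ∀ a ∈ s, θ a = a)
    {n : ℕ} [NeZero n] {ζ : k} (hζ : IsPrimitiveRoot ζ n) {z : F}
    (hz : θ z = algebraMap k F ζ * z) (hzn : z ^ n ∈ IntermediateField.adjoin k s)
    {f : F} (hf : f ∈ IntermediateField.adjoin k (insert z s)) (hθ : θ f = f) :
    f ∈ IntermediateField.adjoin k s := by
  set K := IntermediateField.adjoin k s with hK
  have hθK : ∀ c : K, θ c = c := fun c =>
    eq_of_mem_adjoin (f := (θ : F →ₐ[k] F)) (g := AlgHom.id k F) hs c.2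
  have hle : IntermediateField.adjoin k (insert z s) ≤
      (IntermediateField.adjoin K {z}).restrictScalars k := by
    rw [IntermediateField.adjoin_le_iff]
    rintro a (rfl | ha)
    · exact IntermediateField.mem_adjoin_simple_self K a
    · exact (IntermediateField.adjoin K {z}).algebraMap_mem
        ⟨a, IntermediateField.subset_adjoin k s ha⟩
  have halg : IsIntegral K z := by
    refine IsIntegral.of_pow (NeZero.pos n) ?_
    exact isIntegral_algebraMap (x := (⟨z ^ n, hzn⟩ : K))
  have hf' : f ∈ (IntermediateField.adjoin K {z}).toSubalgebra := hle hf
  rw [IntermediateField.adjoin_simple_toSubalgebra_of_isAlgebraic halg.isAlgebraic,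
    Algebra.adjoin_singleton_eq_range_aeval] at hf'
  obtain ⟨p, hp⟩ := hf'
  have hpow : ∀ j : ℕ, (θ ^ j) f =
      p.sum fun i c => (c : F) * (algebraMap k F (ζ ^ i)) ^ j * z ^ i := by
    intro j
    induction j with
    | zero =>
      rw [pow_zero, AlgEquiv.one_apply, ← hp]
      simp [Polynomial.aeval_eq_sum_range, Polynomial.sum_over_range, Algebra.smul_def]
    | succ j ih =>
      rw [pow_succ', AlgEquiv.mul_apply, ih]
      simp only [Polynomial.sum_def, map_sum, map_mul, map_pow, hθK, hz, AlgEquiv.commutes]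
      exact Finset.sum_congr rfl fun i _ => by ring
  have hfix : ∀ j : ℕ, (θ ^ j) f = f := by
    intro j
    induction j with
    | zero => rfl
    | succ j ih => rw [pow_succ', AlgEquiv.mul_apply, ih, hθ]
  have hsum : (n : F) * f = ∑ i ∈ p.support, (p.coeff i : F) * z ^ i *
      algebraMap k F (∑ j ∈ Finset.range n, (ζ ^ i) ^ j) := by
    calc (n : F) * f = ∑ j ∈ Finset.range n, (θ ^ j) f := by simp [hfix]
      _ = _ := by
        simp only [hpow, Polynomial.sum_def]
        rw [Finset.sum_comm]
        refine Finset.sum_congr rfl fun i _ => ?_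
        rw [map_sum, Finset.mul_sum]
        exact Finset.sum_congr rfl fun j _ => by rw [map_pow _ (ζ ^ i)]; ring
  have : CharZero F := charZero_of_injective_algebraMap (algebraMap k F).injective
  have hmem : (n : F) * f ∈ K := by
    rw [hsum]
    refine sum_mem fun i _ => ?_
    by_cases hi : n ∣ i
    · obtain ⟨m, rfl⟩ := hi
      rw [pow_mul z]
      exact mul_mem (mul_mem (p.coeff _).2 (pow_mem hzn m)) (K.algebraMap_mem _)
    · have h1 : ζ ^ i ≠ 1 := fun h => hi (hζ.dvd_of_pow_eq_one i h)
      have h0 : ∑ j ∈ Finset.range n, (ζ ^ i) ^ j = 0 := by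
        rw [geom_sum_eq h1, ← pow_mul, mul_comm, pow_mul, hζ.pow_eq_one, one_pow, sub_self,
          zero_div]
      rw [h0, map_zero, mul_zero]
      exact zero_mem _
  have hn : (n : F) ≠ 0 := Nat.cast_ne_zero.2 (NeZero.ne n)
  rw [← mul_div_cancel_left₀ f hn]
  exact div_mem hmem (natCast_mem K n)

end Descent

namespace PoissonBracket

variable {k F : Type*} [Field k] [CharZero k] [Field F] [Algebra k F] (P : PoissonBracket k F)

/-- An algebra endomorphism of a field is compatible with the bracket as soon as it is so on a pair
of generators. -/
theorem map_bracket_of_generators {x y : F} (hgen : IntermediateField.adjoin k {x, y} = ⊤)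
    (φ : F →ₐ[k] F) (h : φ (P.bracket y x) = P.bracket (φ y) (φ x)) (a b : F) :
    φ (P.bracket a b) = P.bracket (φ a) (φ b) := by
  have extend : ∀ c : F, φ (P.bracket c x) = P.bracket (φ c) (φ x) →
      φ (P.bracket c y) = P.bracket (φ c) (φ y) →
      ∀ d : F, φ (P.bracket c d) = P.bracket (φ c) (φ d) := by
    intro c hx hy d
    have hd : d ∈ IntermediateField.adjoin k {x, y} := hgen ▸ IntermediateField.mem_top
    induction hd using IntermediateField.adjoin_induction with
    | mem d hd =>
      obtain rfl | rfl := hd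
      exacts [hx, hy]
    | algebraMap r => rw [φ.commutes, bracket_algebraMap_right, bracket_algebraMap_right, map_zero]
    | add d e _ _ hd he => rw [map_add, map_add, hd, he, map_add, map_add]
    | inv d _ hd =>
      rw [bracket_inv_right, map_inv₀, bracket_inv_right, map_div₀, map_neg, map_pow, hd]
    | mul d e _ _ hd he => rw [P.leibniz, map_mul, P.leibniz, map_add, map_mul, map_mul, hd, he]
  have hself : ∀ c, φ (P.bracket c c) = P.bracket (φ c) (φ c) := fun c => by
    rw [bracket_self, bracket_self, map_zero]
  have swap : ∀ c d, φ (P.bracket c d) = P.bracket (φ c) (φ d) →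
      φ (P.bracket d c) = P.bracket (φ d) (φ c) := fun c d hcd => by
    rw [P.antisymm, map_neg, hcd, ← P.antisymm]
  exact extend a (swap _ _ (extend x (hself x) (swap _ _ h) a))
    (swap _ _ (extend y h (hself y) a)) b

/-- If `F = k(x, y)` with `{y, x} = yx` and the subalgebra `A` equals `k(u, v)` with
`{v, u} = vu`, then `A` is Poisson isomorphic to `F`. -/
theorem exists_algEquiv {x y : F} (hgen : IntermediateField.adjoin k {x, y} = ⊤)
    (hx : x ≠ 0) (hy : y ≠ 0) (hP : P.bracket y x = y * x) {u v : F} (hu : u ≠ 0) (hv : v ≠ 0)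
    (huv : P.bracket v u = v * u) {A : Subalgebra k F}
    (hA : ∀ a, a ∈ A ↔ a ∈ IntermediateField.adjoin k {u, v}) :
    ∃ e : A ≃ₐ[k] F, ∀ (a b : A) (hab : P.bracket (a : F) (b : F) ∈ A),
      e ⟨P.bracket (a : F) (b : F), hab⟩ = P.bracket (e a) (e b) := by
  have i1 := P.algebraicIndependent (x := x) (y := y) (by rw [hP]; exact mul_ne_zero hy hx)
  have i2 := P.algebraicIndependent (x := u) (y := v) (by rw [huv]; exact mul_ne_zero hv hu)
  have h1 : IntermediateField.adjoin k (Set.range ![x, y]) = ⊤ := by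
    rw [Matrix.range_cons, Matrix.range_cons, Matrix.range_empty, Set.union_empty,
      Set.singleton_union, hgen]
  have h2 : (IntermediateField.adjoin k (Set.range ![u, v])).toSubalgebra = A := by
    rw [Matrix.range_cons, Matrix.range_cons, Matrix.range_empty, Set.union_empty,
      Set.singleton_union]
    exact SetLike.ext fun a => (hA a).symm
  let e1 : FractionRing (MvPolynomial (Fin 2) k) ≃ₐ[k] F :=
    i1.aevalEquivField.trans ((IntermediateField.equivOfEq h1).trans IntermediateField.topEquiv)
  let e2 : FractionRing (MvPolynomial (Fin 2) k) ≃ₐ[k] A :=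
    i2.aevalEquivField.trans (Subalgebra.equivOfEq _ _ h2)
  have e1X : ∀ i, e1 (algebraMap (MvPolynomial (Fin 2) k) _ (MvPolynomial.X i)) =
      ![x, y] i := fun i =>
    (i1.aevalEquivField_algebraMap_apply_coe (MvPolynomial.X i)).trans
      (MvPolynomial.aeval_X (R := k) ![x, y] i)
  have e2X : ∀ i, (e2 (algebraMap (MvPolynomial (Fin 2) k) _ (MvPolynomial.X i)) : F) =
      ![u, v] i := fun i =>
    (i2.aevalEquivField_algebraMap_apply_coe (MvPolynomial.X i)).trans
      (MvPolynomial.aeval_X (R := k) ![u, v] i)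
  let φ : F →ₐ[k] F := A.val.comp ((e1.symm.trans e2 : F ≃ₐ[k] A) : F →ₐ[k] A)
  have hφ : ∀ i, φ (![x, y] i) = ![u, v] i := fun i => by
    change ((e2 (e1.symm (![x, y] i)) : A) : F) = _
    rw [← e1X, AlgEquiv.symm_apply_apply, e2X]
  have hφx : φ x = u := hφ 0
  have hφy : φ y = v := hφ 1
  have hφP := P.map_bracket_of_generators hgen φ (by
    rw [hP, map_mul, hφx, hφy, huv])
  have hφe : ∀ a : A, φ ((e2.symm.trans e1) a) = a := fun a => by
    change ((e2 (e1.symm (e1 (e2.symm a))) : A) : F) = _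
    rw [AlgEquiv.symm_apply_apply, AlgEquiv.apply_symm_apply]
  have hinj : Function.Injective φ := φ.toRingHom.injective
  refine ⟨e2.symm.trans e1, fun a b hab => hinj ?_⟩
  rw [hφP, hφe, hφe, hφe]

end PoissonBracket

namespace PoissonBracket

variable {k F : Type*} [Field k] [CharZero k] [Field F] [Algebra k F] (P : PoissonBracket k F)

section Inversion

variable {x y : F}

theorem inversion_ne_zero (hx : x ≠ 0) (hy : y ≠ 0) (h : P.bracket y x = y * x) :
    x - x⁻¹ ≠ 0 ∧ y - y⁻¹ ≠ 0 ∧ x * y - (x * y)⁻¹ ≠ 0 := by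
  have i := P.algebraicIndependent (x := x) (y := y) (by rw [h]; exact mul_ne_zero hy hx)
  have key : ∀ a : F, a ≠ 0 → a ^ 2 - 1 ≠ 0 → a - a⁻¹ ≠ 0 := fun a ha h1 h2 => h1 <| by
    have : a ^ 2 - 1 = a * (a - a⁻¹) := by field_simp
    rw [this, h2, mul_zero]
  have h1 := i.aeval_pair_ne_zero (MvPolynomial.X 0 ^ 2 - 1) 0 0 (by simp)
  have h2 := i.aeval_pair_ne_zero (MvPolynomial.X 1 ^ 2 - 1) 0 0 (by simp)
  have h3 := i.aeval_pair_ne_zero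
    ((MvPolynomial.X 0 * MvPolynomial.X 1) ^ 2 - 1) 0 0 (by simp)
  refine ⟨key x hx (by simpa using h1), key y hy (by simpa using h2),
    key _ (mul_ne_zero hx hy) (by simpa using h3)⟩

theorem bracket_inversion (hx : x ≠ 0) (hy : y ≠ 0) (h : P.bracket y x = y * x) :
    P.bracket ((x * y - (x * y)⁻¹) / (y - y⁻¹)) ((x - x⁻¹) / (y - y⁻¹)) =
      (x * y - (x * y)⁻¹) / (y - y⁻¹) * ((x - x⁻¹) / (y - y⁻¹)) := by
  obtain ⟨h1, h2, h3⟩ := P.inversion_ne_zero hx hy h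
  have h' : P.bracket x y = -(y * x) := by rw [P.antisymm, h]
  have e12 : P.bracket (x - x⁻¹) (y - y⁻¹) = -((x + x⁻¹) * (y + y⁻¹)) := by
    simp only [map_sub, LinearMap.sub_apply, bracket_inv_left, bracket_inv_right, h']
    field_simp
    ring
  have e31 : P.bracket (x * y - (x * y)⁻¹) (x - x⁻¹) =
      (x * y + (x * y)⁻¹) * (x + x⁻¹) := by
    simp only [map_sub, LinearMap.sub_apply, bracket_inv_left, bracket_inv_right, h,
      bracket_mul_left, bracket_self]
    field_simp
    ring
  have e32 : P.bracket (x * y - (x * y)⁻¹) (y - y⁻¹) =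
      -((x * y + (x * y)⁻¹) * (y + y⁻¹)) := by
    simp only [map_sub, LinearMap.sub_apply, bracket_inv_left, bracket_inv_right, h',
      bracket_mul_left, bracket_self]
    field_simp
    ring
  rw [bracket_div_left, bracket_div_right, bracket_div_right, bracket_self, e31, e32,
    P.antisymm _ (x - x⁻¹), e12]
  generalize hd : y - y⁻¹ = d at h2
  field_simp
  rw [← hd]
  field_simp
  ring

/-- Generators of the subfield of `k(x, y)` fixed by inversion of `x` and `y`. -/
theorem inversion_fixed_iff (hx : x ≠ 0) (hy : y ≠ 0) (h : P.bracket y x = y * x)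
    {θ : F ≃ₐ[k] F} (hθx : θ x = x⁻¹) (hθy : θ y = y⁻¹) (f : F) :
    f ∈ IntermediateField.adjoin k {x, y} ∧ θ f = f ↔ f ∈ IntermediateField.adjoin k
      {(x - x⁻¹) / (y - y⁻¹), (x * y - (x * y)⁻¹) / (y - y⁻¹)} := by
  obtain ⟨h1, h2, h3⟩ := P.inversion_ne_zero hx hy h
  have : CharZero F := charZero_of_injective_algebraMap (algebraMap k F).injective
  set u := (x - x⁻¹) / (y - y⁻¹) with hu
  set v := (x * y - (x * y)⁻¹) / (y - y⁻¹) with hv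
  have hu0 : u ≠ 0 := div_ne_zero h1 h2
  have hv0 : v ≠ 0 := div_ne_zero h3 h2
  have hb : y + y⁻¹ = (v ^ 2 + u ^ 2 - 1) / (u * v) := by
    rw [eq_div_iff (mul_ne_zero hu0 hv0), hu, hv]
    generalize hd : y - y⁻¹ = d at h2
    field_simp
    rw [← hd]
    field_simp
    ring
  have ha : x + x⁻¹ = 2 * v - u * (y + y⁻¹) := by
    rw [hu, hv]
    generalize hd : y - y⁻¹ = d at h2
    field_simp
    rw [← hd]
    field_simp
    ring
  have hs : ∀ a ∈ ({u, v} : Set F), θ a = a := by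
    rintro a (rfl | rfl)
    · rw [hu, map_div₀, map_sub, map_sub, map_inv₀, map_inv₀, hθx, hθy, inv_inv, inv_inv,
        ← neg_sub x, ← neg_sub y, neg_div_neg_eq]
    · rw [hv, map_div₀, map_sub, map_sub, map_inv₀, map_inv₀, map_mul, hθx, hθy, ← mul_inv,
        inv_inv, inv_inv, ← neg_sub (x * y), ← neg_sub y, neg_div_neg_eq]
  refine ⟨fun ⟨hf, hθ⟩ => ?_, fun hf => ⟨?_, ?_⟩⟩
  rotate_left
  · have hxM : x ∈ IntermediateField.adjoin k {x, y} :=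
      IntermediateField.subset_adjoin _ _ (by simp)
    have hyM : y ∈ IntermediateField.adjoin k {x, y} :=
      IntermediateField.subset_adjoin _ _ (by simp)
    refine (IntermediateField.adjoin_le_iff.2 ?_ :
      IntermediateField.adjoin k {u, v} ≤ IntermediateField.adjoin k {x, y}) hf
    rintro a (rfl | rfl)
    · exact div_mem (sub_mem hxM (inv_mem hxM)) (sub_mem hyM (inv_mem hyM))
    · exact div_mem (sub_mem (mul_mem hxM hyM) (inv_mem (mul_mem hxM hyM)))
        (sub_mem hyM (inv_mem hyM))
  · exact eq_of_mem_adjoin (f := (θ : F →ₐ[k] F)) (g := AlgHom.id k F) hs hf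
  set K := IntermediateField.adjoin k {u, v} with hK
  have huK : u ∈ K := IntermediateField.subset_adjoin _ _ (by simp)
  have hvK : v ∈ K := IntermediateField.subset_adjoin _ _ (by simp)
  have hbK : y + y⁻¹ ∈ K := by
    rw [hb]
    exact div_mem (sub_mem (add_mem (pow_mem hvK 2) (pow_mem huK 2)) (one_mem K))
      (mul_mem huK hvK)
  have haK : x + x⁻¹ ∈ K := by
    rw [ha]
    exact sub_mem (mul_mem (ofNat_mem K 2) hvK) (mul_mem huK hbK)
  refine mem_adjoin_of_fixed hs (IsPrimitiveRoot.neg_one 0 two_ne_zero.symm) (z := x - x⁻¹)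
    (by rw [map_sub, map_inv₀, hθx]; simp) ?_ ?_ hθ
  · have : (x - x⁻¹) ^ 2 = (x + x⁻¹) ^ 2 - 4 := by
      field_simp
      ring
    rw [this]
    exact sub_mem (pow_mem haK 2) (ofNat_mem K 4)
  · set L := IntermediateField.adjoin k (insert (x - x⁻¹) {u, v}) with hL
    have hKL : K ≤ L := IntermediateField.adjoin.mono _ _ _ (Set.subset_insert _ _)
    have hzL : x - x⁻¹ ∈ L := IntermediateField.subset_adjoin _ _ (by simp)
    have hle : IntermediateField.adjoin k {x, y} ≤ L := by
      rw [IntermediateField.adjoin_le_iff]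
      rintro a (rfl | rfl)
      · have : a = ((a + a⁻¹) + (a - a⁻¹)) / 2 := by ring
        rw [this]
        exact div_mem (add_mem (hKL haK) hzL) (ofNat_mem L 2)
      · have : a = ((a + a⁻¹) + (x - x⁻¹) / u) / 2 := by
          rw [hu, div_div_cancel₀ h1]
          ring
        rw [this]
        exact div_mem (add_mem (hKL hbK) (div_mem hzL (hKL huK))) (ofNat_mem L 2)
    exact hle hf

end Inversion

end PoissonBracket

namespace PoissonBracket

variable {k F : Type*} [Field k] [Field F] [Algebra k F] (P : PoissonBracket k F)

/-- The fixed field of `θ` on `k(x, y)` is `k(u, v)` for some `u, v` with `{v, u} = vu`. -/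
def HasLogFixedField (x y : F) (θ : F ≃ₐ[k] F) : Prop :=
  ∃ u ∈ IntermediateField.adjoin k {x, y}, ∃ v ∈ IntermediateField.adjoin k {x, y},
    u ≠ 0 ∧ v ≠ 0 ∧ P.bracket v u = v * u ∧ θ u = u ∧ θ v = v ∧
    ∀ f ∈ IntermediateField.adjoin k {x, y}, θ f = f → f ∈ IntermediateField.adjoin k {u, v}

end PoissonBracket

namespace PoissonBracket

variable {k F : Type*} [Field k] [CharZero k] [Field F] [Algebra k F] {P : PoissonBracket k F}

/-- The automorphism `x ↦ -x⁻¹`, `y ↦ (x - x⁻¹) / y` has a fixed field of logarithmic type. -/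
theorem hasLogFixedField_of_twisted_inversion {x y : F} (hx : x ≠ 0) (hy : y ≠ 0)
    (h : P.bracket y x = y * x) {θ : F ≃ₐ[k] F} (hθx : θ x = -x⁻¹)
    (hθy : θ y = (x - x⁻¹) / y) : P.HasLogFixedField x y θ := by
  have : CharZero F := charZero_of_injective_algebraMap (algebraMap k F).injective
  have h' : P.bracket x y = -(y * x) := by rw [P.antisymm, h]
  have i := P.algebraicIndependent (x := x) (y := y) (by rw [h]; exact mul_ne_zero hy hx)
  have h1 := i.aeval_pair_ne_zero (.X 0 ^ 2 - 1) 0 0 (by simp)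
  have h2 := i.aeval_pair_ne_zero (.X 0 ^ 2 + 1) 0 0 (by simp)
  have h3 := i.aeval_pair_ne_zero
    ((.X 0 * .X 1 ^ 2 - (.X 0 ^ 2 - 1)) ^ 2 - .X 1 ^ 2 * (.X 0 ^ 2 + 1) ^ 2) 0 2
    (by simp; norm_num)
  have h4 := i.aeval_pair_ne_zero
    ((.X 0 * .X 1 ^ 2 - (.X 0 ^ 2 - 1)) ^ 2 + .X 1 ^ 2 * (.X 0 ^ 2 + 1) ^ 2) 0 2
    (by simp; norm_num)
  have n1 : x ^ 2 - 1 ≠ 0 := by simpa using h1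
  have n2 : x ^ 2 + 1 ≠ 0 := by simpa using h2
  have n3 : (x * y ^ 2 - (x ^ 2 - 1)) ^ 2 - y ^ 2 * (x ^ 2 + 1) ^ 2 ≠ 0 := by simpa using h3
  have n4 : (x * y ^ 2 - (x ^ 2 - 1)) ^ 2 + y ^ 2 * (x ^ 2 + 1) ^ 2 ≠ 0 := by simpa using h4
  obtain ⟨t, ht⟩ : ∃ t, t = x - x⁻¹ := ⟨_, rfl⟩
  obtain ⟨r, hr⟩ : ∃ r, r = x + x⁻¹ := ⟨_, rfl⟩
  obtain ⟨w, hw⟩ : ∃ w, w = y - t / y := ⟨_, rfl⟩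
  obtain ⟨m, hm⟩ : ∃ m, m = y + t / y := ⟨_, rfl⟩
  obtain ⟨p, hp⟩ : ∃ p, p = w / r := ⟨_, rfl⟩
  obtain ⟨α, hα⟩ : ∃ α, α = (m - 2 * p) / t := ⟨_, rfl⟩
  have t0 : t ≠ 0 := fun h0 => n1 <| by
    have : x ^ 2 - 1 = x * t := by rw [ht]; field_simp
    rw [this, h0, mul_zero]
  have r0 : r ≠ 0 := fun h0 => n2 <| by
    have : x ^ 2 + 1 = x * r := by rw [hr]; field_simp
    rw [this, h0, mul_zero]
  have hwp : w = p * r := by rw [hp, div_mul_cancel₀ _ r0]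
  have hmα : m = α * t + 2 * p := by rw [hα, div_mul_cancel₀ _ t0, sub_add_cancel]
  have hr2 : r ^ 2 = t ^ 2 + 4 := by
    rw [hr, ht]
    field_simp
    ring
  have hm2 : m ^ 2 = w ^ 2 + 4 * t := by
    rw [hm, hw]
    field_simp
    ring
  have hC : m ^ 2 = (t ^ 2 + 4) * p ^ 2 + 4 * t := by
    rw [hm2, hwp, mul_pow, hr2]
    ring
  have hαp : t * (p ^ 2 - α ^ 2) = 4 * (α * p - 1) := by
    refine mul_left_cancel₀ t0 ?_
    rw [hmα] at hC
    linear_combination -hC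
  have ew : w * (x * y) = x * y ^ 2 - (x ^ 2 - 1) := by
    rw [hw, ht]
    field_simp
  have er : r * (x * y) = y * (x ^ 2 + 1) := by
    rw [hr]
    field_simp
  have hβ : α - p ≠ 0 := fun h0 => n3 <| by
    rw [sub_eq_zero.1 h0, sub_self, mul_zero] at hαp
    have hp1 : p * p - 1 = 0 := (mul_eq_zero.1 hαp.symm).resolve_left (by norm_num)
    rw [← ew, ← mul_pow, ← er, hwp]
    linear_combination (r * (x * y)) ^ 2 * hp1
  have hγ : α + p ≠ 0 := fun h0 => n4 <| by
    rw [eq_neg_of_add_eq_zero_left h0, neg_sq, sub_self, mul_zero] at hαp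
    have hp1 : -p * p - 1 = 0 := (mul_eq_zero.1 hαp.symm).resolve_left (by norm_num)
    rw [← ew, ← mul_pow, ← er, hwp]
    linear_combination -(r * (x * y)) ^ 2 * hp1
  have btx : P.bracket t x = 0 := by
    simp only [ht, map_sub, LinearMap.sub_apply, bracket_inv_left, bracket_self]
    ring
  have btr : P.bracket t r = 0 := by
    simp only [hr, map_add, bracket_inv_right, btx]
    ring
  have bty : P.bracket t y = -(r * y) := by
    simp only [ht, hr, map_sub, LinearMap.sub_apply, bracket_inv_left, h']
    field_simp
    ring
  have byr : P.bracket y r = t * y := by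
    simp only [ht, hr, map_add, bracket_inv_right, h]
    field_simp
    ring
  have btw : P.bracket t w = -(r * m) := by
    simp only [hw, hm, map_sub, bracket_div_right, bracket_self, bty]
    field_simp
    ring
  have btp : P.bracket t p = -m := by
    rw [hp, bracket_div_right, btw, btr]
    field_simp
    ring
  have bmw : P.bracket m w = -(2 * r) := by
    simp only [hw, hm, map_sub, map_add, LinearMap.add_apply, bracket_div_right, bracket_div_left,
      bracket_self, bty, P.antisymm y t]
    field_simp
    ring
  have bmr : P.bracket m r = w * t := by
    simp only [hw, hm, map_add, LinearMap.add_apply, bracket_div_left, byr, btr]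
    field_simp
    ring
  have bmp : P.bracket m p = -(2 + t * p ^ 2) := by
    rw [hp, bracket_div_right, bmw, bmr]
    field_simp
    ring
  have bαp : 2 * P.bracket α p = (α - p) * (α + p) := by
    have e : P.bracket α p = (-(2 + t * p ^ 2) + α * m) / t := by
      rw [hα, bracket_div_left, btp, map_sub, LinearMap.sub_apply, bmp, bracket_mul_left,
        bracket_self, bracket_ofNat_left]
      field_simp
      ring
    rw [e, hmα]
    field_simp
    linear_combination -hαp
  have bγβ : P.bracket (α - p) (α + p) = (α - p) * (α + p) := by
    rw [← bαp]
    simp only [map_sub, map_add, LinearMap.sub_apply, bracket_self, P.antisymm p α]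
    ring
  have θt : θ t = t := by
    rw [ht, map_sub, map_inv₀, hθx, inv_neg, inv_inv]
    ring
  have θr : θ r = -r := by
    rw [hr, map_add, map_inv₀, hθx, inv_neg, inv_inv]
    ring
  have hθy' : θ y = t / y := by rw [hθy, ht]
  have θw : θ w = -w := by
    rw [hw, map_sub, map_div₀, θt, hθy']
    field_simp
    ring
  have θm : θ m = m := by
    rw [hm, map_add, map_div₀, θt, hθy']
    field_simp
    ring
  have θp : θ p = p := by rw [hp, map_div₀, θw, θr, neg_div_neg_eq]
  have θα : θ α = α := by rw [hα, map_div₀, map_sub, map_mul, θm, θp, θt, map_ofNat]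
  have hs : ∀ a ∈ ({α + p, α - p} : Set F), θ a = a := by
    rintro a (rfl | rfl)
    · rw [map_add, θα, θp]
    · rw [map_sub, θα, θp]
  obtain ⟨M, hM⟩ : ∃ M, M = IntermediateField.adjoin k {x, y} := ⟨_, rfl⟩
  have hxM : x ∈ M := hM ▸ IntermediateField.subset_adjoin _ _ (by simp)
  have hyM : y ∈ M := hM ▸ IntermediateField.subset_adjoin _ _ (by simp)
  have htM : t ∈ M := ht ▸ sub_mem hxM (inv_mem hxM)
  have hrM : r ∈ M := hr ▸ add_mem hxM (inv_mem hxM)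
  have hpM : p ∈ M := by
    rw [hp, hw]
    exact div_mem (sub_mem hyM (div_mem htM hyM)) hrM
  have hαM : α ∈ M := by
    rw [hα, hm]
    exact div_mem (sub_mem (add_mem hyM (div_mem htM hyM)) (mul_mem (ofNat_mem M 2) hpM)) htM
  refine ⟨α + p, hM ▸ add_mem hαM hpM, α - p, hM ▸ sub_mem hαM hpM, hγ, hβ, bγβ, hs _ (by simp),
    hs _ (by simp), fun f hf hθ => ?_⟩
  obtain ⟨K, hK⟩ : ∃ K, K = IntermediateField.adjoin k {α + p, α - p} := ⟨_, rfl⟩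
  have hγK : α + p ∈ K := hK ▸ IntermediateField.subset_adjoin _ _ (by simp)
  have hβK : α - p ∈ K := hK ▸ IntermediateField.subset_adjoin _ _ (by simp)
  have hαK : α ∈ K := by
    have : α = ((α + p) + (α - p)) / 2 := by ring
    rw [this]
    exact div_mem (add_mem hγK hβK) (ofNat_mem K 2)
  have hpK : p ∈ K := by
    have : p = ((α + p) - (α - p)) / 2 := by ring
    rw [this]
    exact div_mem (sub_mem hγK hβK) (ofNat_mem K 2)
  have htK : t ∈ K := by
    have : t = 4 * (α * p - 1) / (-((α - p) * (α + p))) := by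
      rw [eq_div_iff (neg_ne_zero.2 (mul_ne_zero hβ hγ)), ← hαp]
      ring
    rw [this]
    exact div_mem (mul_mem (ofNat_mem K 4) (sub_mem (mul_mem hαK hpK) (one_mem K)))
      (neg_mem (mul_mem hβK hγK))
  refine mem_adjoin_of_fixed hs (IsPrimitiveRoot.neg_one 0 two_ne_zero.symm) (z := r)
    (by rw [θr]; simp) ?_ ?_ hθ
  · rw [hr2, ← hK]
    exact add_mem (pow_mem htK 2) (ofNat_mem K 4)
  · obtain ⟨L, hL⟩ : ∃ L, L = IntermediateField.adjoin k (insert r {α + p, α - p}) := ⟨_, rfl⟩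
    have hKL : K ≤ L := by
      rw [hK, hL]
      exact IntermediateField.adjoin.mono _ _ _ (Set.subset_insert _ _)
    have hzL : r ∈ L := hL ▸ IntermediateField.subset_adjoin _ _ (by simp)
    have hle : IntermediateField.adjoin k {x, y} ≤ L := by
      rw [IntermediateField.adjoin_le_iff]
      have hxL : x ∈ L := by
        have : x = (r + t) / 2 := by
          rw [hr, ht]
          ring
        rw [this]
        exact div_mem (add_mem hzL (hKL htK)) (ofNat_mem L 2)
      have hyL : y ∈ L := by
        have : y = ((α * t + 2 * p) + p * r) / 2 := by
          rw [← hmα, ← hwp, hm, hw]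
          ring
        rw [this]
        exact div_mem (add_mem (hKL (add_mem (mul_mem hαK htK) (mul_mem (ofNat_mem K 2) hpK)))
          (mul_mem (hKL hpK) hzL)) (ofNat_mem L 2)
      rintro a (rfl | rfl)
      exacts [hxL, hyL]
    exact hL ▸ hle hf

end PoissonBracket

namespace PoissonBracket

variable {k F : Type*} [Field k] [CharZero k] [Field F] [Algebra k F] {P : PoissonBracket k F}

/-- The automorphism `x ↦ y ↦ (xy)⁻¹` of order three has a fixed field of logarithmic type. -/
theorem hasLogFixedField_of_order_three {ω : k} (hω : IsPrimitiveRoot ω 3) {x y : F} (hx : x ≠ 0)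
    (hy : y ≠ 0) (h : P.bracket y x = y * x) {θ : F ≃ₐ[k] F} (hθx : θ x = y)
    (hθy : θ y = (x * y)⁻¹) : P.HasLogFixedField x y θ := by
  have : CharZero F := charZero_of_injective_algebraMap (algebraMap k F).injective
  have hω1 : ω ≠ 1 := hω.ne_one (by norm_num)
  have hω2 : ω ^ 2 + ω + 1 = 0 := by
    refine (mul_eq_zero.1 (?_ : (ω - 1) * (ω ^ 2 + ω + 1) = 0)).resolve_left (sub_ne_zero.2 hω1)
    linear_combination hω.pow_eq_one
  have hω0 : ω ≠ 0 := hω.ne_zero (by norm_num)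
  have i := P.algebraicIndependent (x := x) (y := y) (by rw [h]; exact mul_ne_zero hy hx)
  let e₀ : MvPolynomial (Fin 2) k := .X 0 * .X 1 + .X 1 + 1
  let e₁ : MvPolynomial (Fin 2) k := .X 0 * .X 1 + .C ω * .X 1 + .C (ω ^ 2)
  let e₂ : MvPolynomial (Fin 2) k := .X 0 * .X 1 + .C (ω ^ 2) * .X 1 + .C ω
  have h0 := i.aeval_pair_ne_zero e₀ 0 0 (by simp [e₀])
  have h1 := i.aeval_pair_ne_zero e₁ 0 0 (by simp [e₁, hω0])
  have h2 := i.aeval_pair_ne_zero e₂ 0 0 (by simp [e₂, hω0])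
  have h3 := i.aeval_pair_ne_zero (e₁ * e₂ - e₀ ^ 2) 1 1 <| by
    simp only [e₀, e₁, e₂, map_sub, map_mul, map_add, map_pow, map_one, MvPolynomial.eval_X,
      MvPolynomial.eval_C, Matrix.cons_val_zero, Matrix.cons_val_one]
    rw [show (1 * 1 + ω * 1 + ω ^ 2) * (1 * 1 + ω ^ 2 * 1 + ω) - (1 * 1 + 1 + 1) ^ 2 = (-9 : k) by
      linear_combination (ω ^ 2 + ω + 1) * hω2]
    norm_num
  have h4 := i.aeval_pair_ne_zero
    (e₁ ^ 2 * e₀ - e₂ * e₀ ^ 2 + .C (ω ^ 2) * (e₁ * e₂ ^ 2 - e₂ * e₀ ^ 2)) 0 1 <| by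
    simp only [e₀, e₁, e₂, map_sub, map_mul, map_add, map_pow, map_one, MvPolynomial.eval_X,
      MvPolynomial.eval_C, Matrix.cons_val_zero, Matrix.cons_val_one]
    grind
  have h5 := i.aeval_pair_ne_zero
    (e₁ ^ 2 * e₀ - e₂ * e₀ ^ 2 + .C ω * (e₁ * e₂ ^ 2 - e₂ * e₀ ^ 2)) 0 1 <| by
    simp only [e₀, e₁, e₂, map_sub, map_mul, map_add, map_pow, map_one, MvPolynomial.eval_X,
      MvPolynomial.eval_C, Matrix.cons_val_zero, Matrix.cons_val_one]
    grind
  obtain ⟨w, hw⟩ : ∃ w, w = algebraMap k F ω := ⟨_, rfl⟩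
  have hwl : ∀ a, P.bracket w a = 0 := fun a => hw ▸ P.bracket_algebraMap_left a ω
  have hwr : ∀ a, P.bracket a w = 0 := fun a => hw ▸ P.bracket_algebraMap_right a ω
  have hw2 : w ^ 2 + w + 1 = 0 := by
    rw [hw, ← map_pow, ← map_one (algebraMap k F), ← map_add, ← map_add, hω2, map_zero]
  have hw3 : w ^ 3 = 1 := by linear_combination (w - 1) * hw2
  have θw : θ w = w := hw ▸ θ.commutes ω
  have hww : w ^ 2 - w ≠ 0 := fun hh => by
    have : w * (w - 1) = 0 := by linear_combination hh
    rcases mul_eq_zero.1 this with h' | h'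
    · rw [h'] at hw3
      norm_num at hw3
    · rw [sub_eq_zero.1 h'] at hw2
      norm_num at hw2
  simp only [e₀, e₁, e₂, map_sub, map_mul, map_add, map_pow, map_one, MvPolynomial.aeval_X,
      MvPolynomial.aeval_C, Matrix.cons_val_zero, Matrix.cons_val_one, ← hw] at h0 h1 h2 h3 h4 h5
  obtain ⟨q, hq⟩ : ∃ q, q = x * y := ⟨_, rfl⟩
  rw [← hq] at h0 h1 h2 h3 h4 h5 hθy
  have hq0 : q ≠ 0 := hq ▸ mul_ne_zero hx hy
  have θq : θ q = y / q := by
    rw [hq, map_mul, hθx, hθy, hq]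
    field_simp
  have hqx : q / y = x := by rw [hq, mul_div_cancel_right₀ _ hy]
  have byq : P.bracket y q = y * q := by
    rw [hq, P.leibniz, bracket_self, h]
    ring
  have bqy : P.bracket q y = -(y * q) := by rw [P.antisymm, byq]
  clear e₀ e₁ e₂
  obtain ⟨e₀, he₀⟩ : ∃ e, e = q + y + 1 := ⟨_, rfl⟩
  obtain ⟨e₁, he₁⟩ : ∃ e, e = q + w * y + w ^ 2 := ⟨_, rfl⟩
  obtain ⟨e₂, he₂⟩ : ∃ e, e = q + w ^ 2 * y + w := ⟨_, rfl⟩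
  rw [← he₀] at h0 h3 h4 h5
  rw [← he₁] at h1 h3 h4 h5
  rw [← he₂] at h2 h3 h4 h5
  have θe₀ : θ e₀ = e₀ / q := by
    rw [he₀, map_add, map_add, θq, hθy, map_one]
    field_simp
    ring
  have θe₁ : θ e₁ = w ^ 2 * e₁ / q := by
    rw [he₁, map_add, map_add, map_mul, map_pow, θq, hθy, θw]
    field_simp
    linear_combination (-w - y) * hw3
  have θe₂ : θ e₂ = w * e₂ / q := by
    rw [he₂, map_add, map_add, map_mul, map_pow, θq, hθy, θw]
    field_simp
    linear_combination (-y) * hw3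
  have hcube : e₀ ^ 3 + e₁ ^ 3 + e₂ ^ 3 - 3 * e₀ * e₁ * e₂ = 27 * q * y := by
    rw [he₀, he₁, he₂]
    clear * - hw2
    grind
  have b12 : P.bracket e₁ e₂ = (w - w ^ 2) * (y * q) := by
    simp only [he₁, he₂, pow_two, map_add, LinearMap.add_apply, P.leibniz, bracket_mul_left,
      bracket_self, hwl, hwr, byq, bqy]
    ring
  have b02 : P.bracket e₀ e₂ = (1 - w ^ 2) * (y * q) := by
    simp only [he₀, he₂, pow_two, map_add, LinearMap.add_apply, P.leibniz,
      bracket_self, hwr, byq, bqy, bracket_one_left]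
    ring
  have b10 : P.bracket e₁ e₀ = (w - 1) * (y * q) := by
    simp only [he₀, he₁, pow_two, map_add, LinearMap.add_apply, bracket_mul_left,
      bracket_self, hwl, byq, bqy, bracket_one_right]
    ring
  obtain ⟨z, hz⟩ : ∃ z, z = e₁ / e₀ := ⟨_, rfl⟩
  obtain ⟨B, hB⟩ : ∃ B, B = e₂ / e₀ := ⟨_, rfl⟩
  have z0 : z ≠ 0 := hz ▸ div_ne_zero h1 h0
  have B0 : B ≠ 0 := hB ▸ div_ne_zero h2 h0
  have bzB : 9 * P.bracket z B = (w - w ^ 2) * (1 + z ^ 3 + B ^ 3 - 3 * z * B) := by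
    have e : P.bracket z B = 3 * (w - w ^ 2) * (q * y) / e₀ ^ 3 := by
      rw [hz, hB, bracket_div_left, bracket_div_right, bracket_div_right, bracket_self, b12,
        b02, b10]
      field_simp
      rw [he₀, he₁, he₂]
      clear * - hw2
      grind
    have e' : 1 + z ^ 3 + B ^ 3 - 3 * z * B = 27 * q * y / e₀ ^ 3 := by
      rw [← hcube, hz, hB]
      field_simp
    rw [e, e']
    ring
  have θz : θ z = w ^ 2 * z := by
    rw [hz, map_div₀, θe₁, θe₀]
    field_simp
  have θB : θ B = w * B := by
    rw [hB, map_div₀, θe₂, θe₀]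
    field_simp
  obtain ⟨a, ha⟩ : ∃ a, a = z * B - 1 := ⟨_, rfl⟩
  obtain ⟨b, hb⟩ : ∃ b, b = z ^ 2 / B - 1 := ⟨_, rfl⟩
  have a0 : a ≠ 0 := fun hh => h3 <| by
    rw [show e₁ * e₂ - e₀ ^ 2 = a * e₀ ^ 2 by rw [ha, hz, hB]; field_simp, hh, zero_mul]
  have c1 : e₁ ^ 2 * e₀ - e₂ * e₀ ^ 2 = b * (e₂ * e₀ ^ 2) := by
    rw [hb, hz, hB]
    field_simp
  have c2 : e₁ * e₂ ^ 2 - e₂ * e₀ ^ 2 = a * (e₂ * e₀ ^ 2) := by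
    rw [ha, hz, hB]
    field_simp
  rw [c1, c2] at h4 h5
  obtain ⟨N, hN⟩ : ∃ N, N = a ^ 2 - a * b + b ^ 2 + a * b ^ 2 := ⟨_, rfl⟩
  have hN' : N = z ^ 2 / B * (1 + z ^ 3 + B ^ 3 - 3 * z * B) := by
    rw [hN, ha, hb]
    field_simp
    ring
  have N0 : N ≠ 0 := by
    have : 1 + z ^ 3 + B ^ 3 - 3 * z * B = 27 * q * y / e₀ ^ 3 := by
      rw [← hcube, hz, hB]
      field_simp
    rw [hN', this]
    refine mul_ne_zero (div_ne_zero (pow_ne_zero 2 z0) B0)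
      (div_ne_zero (mul_ne_zero (mul_ne_zero (by norm_num) hq0) hy) (pow_ne_zero 3 h0))
  have bab : 3 * P.bracket a b = (w ^ 2 - w) * N := by
    have e : P.bracket a b = -3 * (z ^ 2 / B) * P.bracket z B := by
      simp only [ha, hb, map_sub, LinearMap.sub_apply, bracket_div_right, bracket_mul_left,
        bracket_pow_right, bracket_self, bracket_one_left, bracket_one_right, P.antisymm B z]
      push_cast
      field_simp
      ring
    rw [e, hN']
    linear_combination -(z ^ 2 / B) * bzB
  have θa : θ a = a := by
    rw [ha, map_sub, map_mul, θz, θB, map_one]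
    linear_combination (z * B) * hw3
  have θb : θ b = b := by
    rw [hb, map_sub, map_div₀, map_pow, θz, θB, map_one]
    have w0 : w ≠ 0 := fun hh => by simp [hh] at hw3
    field_simp
    linear_combination (z ^ 2) * hw3
  obtain ⟨s, hs⟩ : ∃ s, s = b / a := ⟨_, rfl⟩
  have hbs : b = s * a := by rw [hs, div_mul_cancel₀ _ a0]
  have m1 : s + w ^ 2 ≠ 0 := fun hh => h4 <| by
    rw [hbs]
    linear_combination (a * (e₂ * e₀ ^ 2)) * hh
  have m2 : s + w ≠ 0 := fun hh => h5 <| by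
    rw [hbs]
    linear_combination (a * (e₂ * e₀ ^ 2)) * hh
  obtain ⟨ρ, hρ⟩ : ∃ ρ, ρ = (s + w) * (s + w ^ 2) / a + s ^ 2 := ⟨_, rfl⟩
  obtain ⟨n, hn⟩ : ∃ n, n = (s + w) / (s + w ^ 2) := ⟨_, rfl⟩
  have hσ : (s + w) * (s + w ^ 2) = s ^ 2 - s + 1 := by
    linear_combination s * hw2 + hw3
  have hNρ : N = ρ * a ^ 3 := by
    rw [hN, hρ, hσ, hbs]
    field_simp
    ring
  have ρ0 : ρ ≠ 0 := fun hh => N0 <| by rw [hNρ, hh, zero_mul]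
  have n0 : n ≠ 0 := hn ▸ div_ne_zero m2 m1
  have n1 : n - 1 ≠ 0 := by
    have : n - 1 = -(w ^ 2 - w) / (s + w ^ 2) := by
      rw [hn]
      field_simp
      ring
    rw [this]
    exact div_ne_zero (neg_ne_zero.2 hww) m1
  have bas : 3 * P.bracket a s = (w ^ 2 - w) * (ρ * a ^ 2) := by
    have : 3 * P.bracket a s = 3 * P.bracket a b / a := by
      rw [hs, bracket_div_right, bracket_self]
      ring
    rw [this, bab, hNρ]
    field_simp
  have bρs : 3 * P.bracket ρ s = -(w ^ 2 - w) * ((s + w) * (s + w ^ 2)) * ρ := by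
    have : P.bracket ρ s = - (((s + w) * (s + w ^ 2)) / a ^ 2) * P.bracket a s := by
      simp only [hρ, pow_two, map_add, LinearMap.add_apply, bracket_div_left, bracket_mul_left,
        bracket_self, hwl]
      ring
    rw [this]
    field_simp
    linear_combination -bas
  have bρn : P.bracket ρ n = ρ * n := by
    have : P.bracket ρ n = (w ^ 2 - w) / (s + w ^ 2) ^ 2 * P.bracket ρ s := by
      simp only [hn, bracket_div_right, pow_two, map_add, P.leibniz, hwr]
      field_simp
      ring
    have e : 3 * P.bracket ρ n = 3 * (ρ * n) := by
      rw [this, mul_left_comm, bρs, hn]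
      field_simp
      clear * - hw2
      grind
    exact mul_left_cancel₀ (by norm_num) e
  have θs : θ s = s := by rw [hs, map_div₀, θa, θb]
  have θρ : θ ρ = ρ := by
    rw [hρ, map_add, map_div₀, map_mul, map_add, map_add, map_pow, map_pow, θa, θs, θw]
  have θn : θ n = n := by rw [hn, map_div₀, map_add, map_add, map_pow, θs, θw]
  have hfix : ∀ a ∈ ({n, ρ} : Set F), θ a = a := by
    rintro a (rfl | rfl)
    exacts [θn, θρ]
  obtain ⟨M, hM⟩ : ∃ M, M = IntermediateField.adjoin k {x, y} := ⟨_, rfl⟩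
  have hwm : ∀ K : IntermediateField k F, w ∈ K := fun K => hw ▸ K.algebraMap_mem ω
  have hxM : x ∈ M := hM ▸ IntermediateField.subset_adjoin _ _ (by simp)
  have hyM : y ∈ M := hM ▸ IntermediateField.subset_adjoin _ _ (by simp)
  have hqM : q ∈ M := hq ▸ mul_mem hxM hyM
  have he₀M : e₀ ∈ M := he₀ ▸ add_mem (add_mem hqM hyM) (one_mem M)
  have he₁M : e₁ ∈ M := he₁ ▸ add_mem (add_mem hqM (mul_mem (hwm M) hyM)) (pow_mem (hwm M) 2)
  have he₂M : e₂ ∈ M := he₂ ▸ add_mem (add_mem hqM (mul_mem (pow_mem (hwm M) 2) hyM)) (hwm M)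
  have hzM : z ∈ M := hz ▸ div_mem he₁M he₀M
  have hBM : B ∈ M := hB ▸ div_mem he₂M he₀M
  have haM : a ∈ M := ha ▸ sub_mem (mul_mem hzM hBM) (one_mem M)
  have hbM : b ∈ M := hb ▸ sub_mem (div_mem (pow_mem hzM 2) hBM) (one_mem M)
  have hsM : s ∈ M := hs ▸ div_mem hbM haM
  have m1M : s + w ∈ M := add_mem hsM (hwm M)
  have m2M : s + w ^ 2 ∈ M := add_mem hsM (pow_mem (hwm M) 2)
  have hρM : ρ ∈ M := hρ ▸ add_mem (div_mem (mul_mem m1M m2M) haM) (pow_mem hsM 2)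
  have hnM : n ∈ M := hn ▸ div_mem m1M m2M
  refine ⟨n, hM ▸ hnM, ρ, hM ▸ hρM, n0, ρ0, bρn, θn, θρ, fun f hf hθ => ?_⟩
  obtain ⟨K, hK⟩ : ∃ K, K = IntermediateField.adjoin k {n, ρ} := ⟨_, rfl⟩
  have hnK : n ∈ K := hK ▸ IntermediateField.subset_adjoin _ _ (by simp)
  have hρK : ρ ∈ K := hK ▸ IntermediateField.subset_adjoin _ _ (by simp)
  have hsK : s ∈ K := by
    have : s = (w - n * w ^ 2) / (n - 1) := by
      rw [eq_div_iff n1, hn]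
      field_simp
      ring
    rw [this]
    exact div_mem (sub_mem (hwm K) (mul_mem hnK (pow_mem (hwm K) 2))) (sub_mem hnK (one_mem K))
  have haK : a ∈ K := by
    have : a = (s + w) * (s + w ^ 2) / (ρ - s ^ 2) := by
      rw [hρ, add_sub_cancel_right, div_div_cancel₀ (mul_ne_zero m2 m1)]
    rw [this]
    exact div_mem (mul_mem (add_mem hsK (hwm K)) (add_mem hsK (pow_mem (hwm K) 2)))
      (sub_mem hρK (pow_mem hsK 2))
  have hbK : b ∈ K := hbs ▸ mul_mem hsK haK
  refine mem_adjoin_of_fixed hfix (hω.pow_of_coprime 2 (by norm_num)) (z := z)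
    (by rw [θz, map_pow, hw]) ?_ ?_ hθ
  · have : z ^ 3 = (a + 1) * (b + 1) := by
      rw [ha, hb]
      field_simp
      ring
    rw [this, ← hK]
    exact mul_mem (add_mem haK (one_mem K)) (add_mem hbK (one_mem K))
  · obtain ⟨L, hL⟩ : ∃ L, L = IntermediateField.adjoin k (insert z {n, ρ}) := ⟨_, rfl⟩
    have hKL : K ≤ L := by
      rw [hK, hL]
      exact IntermediateField.adjoin.mono _ _ _ (Set.subset_insert _ _)
    have hzL : z ∈ L := hL ▸ IntermediateField.subset_adjoin _ _ (by simp)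
    have hBL : B ∈ L := by
      have : B = (a + 1) / z := by
        rw [ha]
        field_simp
        ring
      rw [this]
      exact div_mem (hKL (add_mem haK (one_mem K))) hzL
    have hyL : y / e₀ ∈ L := by
      have : y / e₀ = (1 + w ^ 2 * z + w * B) / 3 := by
        rw [hz, hB]
        field_simp
        rw [he₀, he₁, he₂]
        clear * - hw2
        grind
      rw [this]
      exact div_mem (add_mem (add_mem (one_mem L) (mul_mem (pow_mem (hwm L) 2) hzL))
        (mul_mem (hwm L) hBL)) (ofNat_mem L 3)
    have hqL : q / e₀ ∈ L := by
      have : q / e₀ = (1 + z + B) / 3 := by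
        rw [hz, hB]
        field_simp
        rw [he₀, he₁, he₂]
        linear_combination (-y - 1) * hw2
      rw [this]
      exact div_mem (add_mem (add_mem (one_mem L) hzL) hBL) (ofNat_mem L 3)
    have hle : IntermediateField.adjoin k {x, y} ≤ L := by
      rw [IntermediateField.adjoin_le_iff]
      rintro c (rfl | rfl)
      · rw [← hqx, ← div_div_div_cancel_right₀ h0]
        exact div_mem hqL hyL
      · have : c = (c / e₀) / (1 - q / e₀ - c / e₀) := by
          have : 1 - q / e₀ - c / e₀ = 1 / e₀ := by
            field_simp
            rw [he₀]
            ring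
          rw [this, div_div_div_cancel_right₀ h0, div_one]
        rw [this]
        exact div_mem hyL (sub_mem (sub_mem (one_mem L) hqL) hyL)
    exact hL ▸ hle hf

end PoissonBracket

section FiniteSubgroups

open Matrix Matrix.SpecialLinearGroup

/-- A matrix of order three in `SL(2, ℤ)`. -/
def orderThree : SpecialLinearGroup (Fin 2) ℤ := ⟨!![-1, 1; -1, 0], by simp⟩

/-- Generating sets of representatives of the conjugacy classes of finite subgroups of
`SL(2, ℤ)`. -/
def standardGenerators : Set (Set (SpecialLinearGroup (Fin 2) ℤ)) :=
  {∅, {-1}, {ModularGroup.S}, {orderThree}, {-1, orderThree ^ 2}}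

/-- The automorphs of a reduced positive definite binary quadratic form. -/
theorem automorph_of_reduced {A B C p s r t : ℤ} (hA : 0 < A) (hC : 0 < C) (hB : B ≤ 0)
    (hAB : 0 ≤ A + 2 * B) (hCB : 0 ≤ C + 2 * B)
    (h00 : A * p ^ 2 + 2 * B * (p * r) + C * r ^ 2 = A)
    (h01 : A * (p * s) + B * (p * t + r * s) + C * (r * t) = B)
    (h11 : A * s ^ 2 + 2 * B * (s * t) + C * t ^ 2 = C) (hdet : p * t - s * r = 1) :
    s = 0 ∧ r = 0 ∧ (p = 1 ∧ t = 1 ∨ p = -1 ∧ t = -1) ∨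
    B = 0 ∧ p = 0 ∧ t = 0 ∧ (s = -1 ∧ r = 1 ∨ s = 1 ∧ r = -1) ∨
    B ≠ 0 ∧ (p = -1 ∧ s = 1 ∧ r = -1 ∧ t = 0 ∨ p = 1 ∧ s = -1 ∧ r = 1 ∧ t = 0 ∨
      p = 0 ∧ s = -1 ∧ r = 1 ∧ t = -1 ∨ p = 0 ∧ s = 1 ∧ r = -1 ∧ t = 1) := by
  have bound : ∀ X Y u v : ℤ, 0 < X → 0 ≤ X + 2 * B → 0 ≤ Y + 2 * B →
      X * u ^ 2 + 2 * B * (u * v) + Y * v ^ 2 = X → -1 ≤ u ∧ u ≤ 1 := by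
    intro X Y u v hX h1 h2 h
    have : X * u ^ 2 ≤ X * 2 := by
      nlinarith [mul_nonneg (neg_nonneg.2 hB) (sq_nonneg (u - v)), mul_nonneg h1 (sq_nonneg u),
        mul_nonneg h2 (sq_nonneg v)]
    have : u ^ 2 ≤ 2 := le_of_mul_le_mul_left this hX
    constructor <;> nlinarith
  obtain ⟨hp1, hp2⟩ := bound A C p r hA hAB hCB h00
  obtain ⟨ht1, ht2⟩ := bound C A t s hC hCB hAB (by linarith)
  have unit : ∀ X u c : ℤ, 0 < X → 0 ≤ X + 2 * B → c = 1 ∨ c = -1 → u ≠ 0 →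
      2 * B * (c * u) + X * u ^ 2 = 0 → u = 1 ∨ u = -1 := by
    intro X u c hX h1 hc hu h
    have h2 : X * u = -2 * B * c := mul_right_cancel₀ hu (by linear_combination h)
    have h3 : -1 ≤ u ∧ u ≤ 1 := by
      obtain rfl | rfl := hc <;> constructor <;> nlinarith
    omega
  have two : s * r = -2 → False := by
    intro h
    have hs : s ≠ 0 := by
      rintro rfl
      simp at h
    have hr : r ≠ 0 := by
      rintro rfl
      simp at h
    have hpt : p * t = -1 := by linarith
    have hr1 : r = 1 ∨ r = -1 := by
      refine unit C r p hC hCB ?_ hr ?_ <;>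
        obtain ⟨rfl, rfl⟩ | ⟨rfl, rfl⟩ := Int.mul_eq_neg_one_iff_eq_one_or_neg_one.1 hpt <;>
        first | linarith | simp
    have hs1 : s = 1 ∨ s = -1 := by
      refine unit A s t hA hAB ?_ hs ?_ <;>
        obtain ⟨rfl, rfl⟩ | ⟨rfl, rfl⟩ := Int.mul_eq_neg_one_iff_eq_one_or_neg_one.1 hpt <;>
        first | linarith | simp
    rcases hr1 with rfl | rfl <;> rcases hs1 with rfl | rfl <;> simp at h
  have one : s * r = -1 → s = 1 ∧ r = -1 ∨ s = -1 ∧ r = 1 :=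
    Int.mul_eq_neg_one_iff_eq_one_or_neg_one.1
  have zero : s * r = 0 → p * t = 1 → s = 0 ∧ r = 0 := by
    intro h h'
    rcases mul_eq_zero.1 h with rfl | rfl
    · have : C * (r * t) = 0 := by linear_combination h01 - B * h'
      have ht : t ≠ 0 := right_ne_zero_of_mul_eq_one h'
      simpa [hC.ne', ht] using this
    · have : A * (p * s) = 0 := by linear_combination h01 - B * h'
      have hp : p ≠ 0 := left_ne_zero_of_mul_eq_one h'
      simpa [hA.ne', hp] using this
  have hpt : p * t = 1 ∨ p * t = 0 ∨ p * t = -1 := by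
    interval_cases p <;> interval_cases t <;> simp
  rcases hpt with h | h | h
  · obtain ⟨rfl, rfl⟩ := zero (by linarith) h
    exact Or.inl ⟨rfl, rfl, Int.mul_eq_one_iff_eq_one_or_neg_one.1 h⟩
  · rcases mul_eq_zero.1 h with rfl | rfl
    · obtain ⟨rfl, rfl⟩ | ⟨rfl, rfl⟩ := one (by linarith) <;> interval_cases t <;> omega
    · obtain ⟨rfl, rfl⟩ | ⟨rfl, rfl⟩ := one (by linarith) <;> interval_cases p <;> omega
  · exact (two (by linarith)).elim

/-- A finite subgroup of `SL(2, ℤ)` is conjugate to one preserving a reduced positive definite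
binary quadratic form. -/
theorem exists_reduced_form (G : Subgroup (SpecialLinearGroup (Fin 2) ℤ)) [Finite G] :
    ∃ (γ : SpecialLinearGroup (Fin 2) ℤ) (M : Matrix (Fin 2) (Fin 2) ℤ),
      M 1 0 = M 0 1 ∧ 0 < M 0 0 ∧ 0 < M 1 1 ∧ M 0 1 ≤ 0 ∧ 0 ≤ M 0 0 + 2 * M 0 1 ∧
      0 ≤ M 1 1 + 2 * M 0 1 ∧
      ∀ h, γ * h * γ⁻¹ ∈ G → (h : Matrix (Fin 2) (Fin 2) ℤ)ᵀ * M * h = M := by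
  have := Fintype.ofFinite G
  let N : SpecialLinearGroup (Fin 2) ℤ → Matrix (Fin 2) (Fin 2) ℤ := fun γ =>
    ∑ g : G, ((g * γ : SpecialLinearGroup (Fin 2) ℤ) : Matrix (Fin 2) (Fin 2) ℤ)ᵀ *
      ((g * γ : SpecialLinearGroup (Fin 2) ℤ) : Matrix (Fin 2) (Fin 2) ℤ)
  have hmul : ∀ γ δ, N (γ * δ) = (δ : Matrix (Fin 2) (Fin 2) ℤ)ᵀ * N γ * δ := by
    intro γ δ
    simp only [N, Finset.mul_sum, Finset.sum_mul]
    refine Finset.sum_congr rfl fun g _ => ?_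
    simp only [coe_mul, transpose_mul, Matrix.mul_assoc]
  have hinv : ∀ g ∈ G, ∀ γ, N (g * γ) = N γ := by
    intro g hg γ
    refine Fintype.sum_equiv (Equiv.mulRight ⟨g, hg⟩) _ _ fun a => ?_
    simp [mul_assoc]
  have hsymm : ∀ γ, N γ 1 0 = N γ 0 1 := by
    intro γ
    simp only [N, Matrix.sum_apply, Matrix.mul_apply, transpose_apply]
    exact Finset.sum_congr rfl fun g _ => Finset.sum_congr rfl fun i _ => mul_comm _ _
  have hpos : ∀ γ i, 0 < N γ i i := by
    intro γ i
    simp only [N, Matrix.sum_apply, Matrix.mul_apply, transpose_apply, Fin.sum_univ_two]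
    refine Finset.sum_pos (fun g _ => ?_) Finset.univ_nonempty
    have hdet := Matrix.SpecialLinearGroup.det_coe ((g : SpecialLinearGroup (Fin 2) ℤ) * γ)
    rw [Matrix.det_fin_two] at hdet
    generalize ((g * γ : SpecialLinearGroup (Fin 2) ℤ) : Matrix (Fin 2) (Fin 2) ℤ) = m at hdet
    by_contra! hle
    have h0 : m 0 i = 0 := by nlinarith [mul_self_nonneg (m 0 i), mul_self_nonneg (m 1 i)]
    have h1 : m 1 i = 0 := by nlinarith [mul_self_nonneg (m 0 i), mul_self_nonneg (m 1 i)]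
    fin_cases i <;> simp_all
  obtain ⟨γ, hγ⟩ : ∃ γ, ∀ δ, N γ 0 0 + N γ 1 1 ≤ N δ 0 0 + N δ 1 1 := by
    let f : SpecialLinearGroup (Fin 2) ℤ → ℕ := fun γ => (N γ 0 0 + N γ 1 1).toNat
    refine ⟨Function.argmin f, fun δ => ?_⟩
    have h1 : f (Function.argmin f) ≤ f δ := Function.argmin_le f δ
    have h2 := hpos δ 0
    have h3 := hpos δ 1
    simp only [f] at h1 ⊢
    omega
  have hS : ∀ γ, N (γ * ModularGroup.S) = !![N γ 1 1, -N γ 0 1; -N γ 0 1, N γ 0 0] := by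
    intro γ
    rw [hmul, ModularGroup.coe_S]
    ext i j
    fin_cases i <;> fin_cases j <;>
      simp [Matrix.mul_apply, Fin.sum_univ_two, hsymm γ]
  obtain ⟨γ, hγ, hB⟩ :
      ∃ γ, (∀ δ, N γ 0 0 + N γ 1 1 ≤ N δ 0 0 + N δ 1 1) ∧ N γ 0 1 ≤ 0 := by
    rcases le_total (N γ 0 1) 0 with h | h
    · exact ⟨γ, hγ, h⟩
    · refine ⟨γ * ModularGroup.S, fun δ => ?_, ?_⟩
      · have := hγ δ
        simp only [hS]
        simpa [add_comm] using this
      · simpa [hS] using h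
  refine ⟨γ, N γ, hsymm γ, hpos γ 0, hpos γ 1, hB, ?_, ?_, fun h hh => ?_⟩
  · have h1 := hγ (γ * ModularGroup.T)
    rw [hmul, ModularGroup.coe_T] at h1
    simp [Matrix.mul_apply, Fin.sum_univ_two, hsymm γ] at h1
    linarith
  · have h1 := hγ (γ * ModularGroup.Tᵀ)
    rw [hmul, coe_transpose, ModularGroup.coe_T] at h1
    simp only [Matrix.mul_apply, Fin.sum_univ_two, transpose_apply, hsymm γ, of_apply, cons_val',
      cons_val_zero, cons_val_one, cons_val_fin_one] at h1
    linarith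
  · rw [← hmul, ← hinv _ hh γ]
    simp

/-- Classification of the finite subgroups of `SL(2, ℤ)` up to conjugacy. -/
theorem exists_comap_conj_eq (G : Subgroup (SpecialLinearGroup (Fin 2) ℤ)) [Finite G] :
    ∃ γ : SpecialLinearGroup (Fin 2) ℤ, ∃ T ∈ standardGenerators,
      G.comap (MulAut.conj γ).toMonoidHom = Subgroup.closure T := by
  obtain ⟨γ, M, hsymm, hA, hC, hB, hAB, hCB, hM⟩ := exists_reduced_form G
  refine ⟨γ, ?_⟩
  obtain ⟨H, hH⟩ : ∃ H, H = G.comap (MulAut.conj γ).toMonoidHom := ⟨_, rfl⟩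
  have mem : ∀ h ∈ H, (h = 1 ∨ h = -1) ∨ M 0 1 = 0 ∧ (h = ModularGroup.S ∨ h = -ModularGroup.S) ∨
      M 0 1 ≠ 0 ∧ (h = orderThree ∨ h = -orderThree ∨ h = orderThree ^ 2 ∨
        h = -orderThree ^ 2) := by
    intro h hh
    rw [hH] at hh
    have hMh := hM h hh
    have e : ∀ i j, ((h : Matrix (Fin 2) (Fin 2) ℤ)ᵀ * M * h) i j = M i j := fun i j => by rw [hMh]
    have hdet := h.det_coe
    rw [Matrix.det_fin_two] at hdet
    have e00 := e 0 0
    have e01 := e 0 1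
    have e11 := e 1 1
    simp only [Matrix.mul_apply, Fin.sum_univ_two, transpose_apply, hsymm] at e00 e01 e11
    have key := automorph_of_reduced hA hC hB hAB hCB (p := h 0 0) (s := h 0 1) (r := h 1 0)
      (t := h 1 1) (by linarith) (by linarith) (by linarith) hdet
    have of : ∀ g : SpecialLinearGroup (Fin 2) ℤ, h 0 0 = g 0 0 → h 0 1 = g 0 1 →
        h 1 0 = g 1 0 → h 1 1 = g 1 1 → h = g := fun g h1 h2 h3 h4 =>
      by ext i j; fin_cases i <;> fin_cases j <;> assumption
    rcases key with ⟨hs, hr, ⟨hp, ht⟩ | ⟨hp, ht⟩⟩ | ⟨h0, hp, ht, ⟨hs, hr⟩ | ⟨hs, hr⟩⟩ |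
      ⟨h0, ⟨hp, hs, hr, ht⟩ | ⟨hp, hs, hr, ht⟩ | ⟨hp, hs, hr, ht⟩ | ⟨hp, hs, hr, ht⟩⟩
    · exact .inl (.inl (of 1 hp hs hr ht))
    · exact .inl (.inr (of (-1) hp hs hr ht))
    · exact .inr (.inl ⟨h0, .inl (of _ hp hs hr ht)⟩)
    · exact .inr (.inl ⟨h0, .inr (of _ hp hs hr ht)⟩)
    · exact .inr (.inr ⟨h0, .inl (of _ hp hs hr ht)⟩)
    · exact .inr (.inr ⟨h0, .inr (.inl (of _ hp hs hr ht))⟩)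
    · exact .inr (.inr ⟨h0, .inr (.inr (.inl (of (orderThree ^ 2) hp hs hr ht)))⟩)
    · exact .inr (.inr ⟨h0, .inr (.inr (.inr (of (-orderThree ^ 2) hp hs hr ht)))⟩)
  rw [← hH]
  have s2 : ModularGroup.S ^ 2 = -1 := by
    ext i j
    fin_cases i <;> fin_cases j <;> rfl
  have s3 : ModularGroup.S ^ 3 = -ModularGroup.S := by rw [pow_succ, s2, neg_mul, one_mul]
  have w3 : orderThree ^ 3 = 1 := by
    ext i j
    fin_cases i <;> fin_cases j <;> rfl
  have w4 : orderThree ^ 4 = orderThree := by rw [pow_succ, w3, one_mul]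
  have small : (∀ h ∈ H, h = 1 ∨ h = -1) →
      ∃ T ∈ standardGenerators, H = Subgroup.closure T := by
    intro hh
    by_cases h1 : -1 ∈ H
    · refine ⟨{-1}, by simp [standardGenerators], le_antisymm (fun h hm => ?_)
        ((Subgroup.closure_le _).2 (by simpa using h1))⟩
      rcases hh h hm with rfl | rfl
      exacts [one_mem _, Subgroup.subset_closure rfl]
    · refine ⟨∅, by simp [standardGenerators], le_antisymm (fun h hm => ?_)
        ((Subgroup.closure_le _).2 (by simp))⟩
      rcases hh h hm with rfl | rfl
      exacts [one_mem _, (h1 hm).elim]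
  by_cases hM0 : M 0 1 = 0
  · by_cases hS : ModularGroup.S ∈ H
    · refine ⟨{ModularGroup.S}, by simp [standardGenerators], le_antisymm (fun h hm => ?_)
        ((Subgroup.closure_le _).2 (by simpa using hS))⟩
      have hS' : ModularGroup.S ∈ Subgroup.closure {ModularGroup.S} :=
        Subgroup.subset_closure rfl
      rcases mem h hm with (rfl | rfl) | ⟨-, rfl | rfl⟩ | ⟨h0, -⟩
      exacts [one_mem _, s2 ▸ pow_mem hS' 2, hS', s3 ▸ pow_mem hS' 3, (h0 hM0).elim]
    · refine small fun h hm => ?_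
      rcases mem h hm with hh | ⟨-, rfl | rfl⟩ | ⟨h0, -⟩
      · exact hh
      · exact (hS hm).elim
      · refine (hS ?_).elim
        have := pow_mem hm 3
        rwa [Odd.neg_pow (by decide), s3, neg_neg] at this
      · exact (h0 hM0).elim
  · by_cases hW : orderThree ∈ H
    · by_cases h1 : -1 ∈ H
      · refine ⟨{-1, orderThree ^ 2}, by simp [standardGenerators], le_antisymm
          (fun h hm => ?_)
          ((Subgroup.closure_le _).2 (by simp [Set.insert_subset_iff, h1, pow_mem hW]))⟩
        have hW2 : orderThree ^ 2 ∈ Subgroup.closure {-1, orderThree ^ 2} :=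
          Subgroup.subset_closure (by simp)
        have hW' : orderThree ∈ Subgroup.closure {-1, orderThree ^ 2} := by
          have := pow_mem hW2 2
          rwa [← pow_mul, w4] at this
        have h1' : -1 ∈ Subgroup.closure {-1, orderThree ^ 2} :=
          Subgroup.subset_closure (by simp)
        rcases mem h hm with (rfl | rfl) | ⟨h0, -⟩ | ⟨-, rfl | rfl | rfl | rfl⟩
        exacts [one_mem _, h1', (hM0 h0).elim, hW', neg_one_mul orderThree ▸ mul_mem h1' hW',
          hW2, neg_one_mul (orderThree ^ 2) ▸ mul_mem h1' hW2]
      · refine ⟨{orderThree}, by simp [standardGenerators], le_antisymm (fun h hm => ?_)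
          ((Subgroup.closure_le _).2 (by simpa using hW))⟩
        have hW' : orderThree ∈ Subgroup.closure {orderThree} := Subgroup.subset_closure rfl
        have cube : ∀ g, g ^ 3 = -1 → g ∉ H := fun g hg hm => h1 (hg ▸ pow_mem hm 3)
        rcases mem h hm with (rfl | rfl) | ⟨h0, -⟩ | ⟨-, rfl | rfl | rfl | rfl⟩
        · exact one_mem _
        · exact (h1 hm).elim
        · exact (hM0 h0).elim
        · exact hW'
        · exact (cube _ (by rw [Odd.neg_pow (by decide), w3]) hm).elim
        · exact pow_mem hW' 2
        · refine (cube _ ?_ hm).elim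
          rw [Odd.neg_pow (by decide), ← pow_mul, mul_comm, pow_mul, w3, one_pow]
    · refine small fun h hm => ?_
      rcases mem h hm with hh | ⟨h0, -⟩ | ⟨-, rfl | rfl | rfl | rfl⟩
      · exact hh
      · exact (hM0 h0).elim
      · exact (hW hm).elim
      · refine (hW ?_).elim
        have := pow_mem hm 4
        rwa [Even.neg_pow (by decide), w4] at this
      · refine (hW ?_).elim
        have := pow_mem hm 2
        rwa [← pow_mul, w4] at this
      · refine (hW ?_).elim
        have := pow_mem hm 2
        rwa [Even.neg_pow (by decide), ← pow_mul, w4] at this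

end FiniteSubgroups

namespace PoissonBracket

variable {k F : Type*} [Field k] [Field F] [Algebra k F] {P : PoissonBracket k F}

theorem HasLogFixedField.exists_iff {x y : F} {θ : F ≃ₐ[k] F} (H : P.HasLogFixedField x y θ) :
    ∃ u v : F, u ≠ 0 ∧ v ≠ 0 ∧ P.bracket v u = v * u ∧
      ∀ f, f ∈ IntermediateField.adjoin k {x, y} ∧ θ f = f ↔
        f ∈ IntermediateField.adjoin k {u, v} := by
  obtain ⟨u, hu, v, hv, hu0, hv0, hvu, θu, θv, hfix⟩ := H
  refine ⟨u, v, hu0, hv0, hvu, fun f => ⟨fun hf => hfix f hf.1 hf.2, fun hf => ⟨?_, ?_⟩⟩⟩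
  · refine (IntermediateField.adjoin_le_iff.2 ?_ :
      IntermediateField.adjoin k {u, v} ≤ IntermediateField.adjoin k {x, y}) hf
    rintro a (rfl | rfl)
    exacts [hu, hv]
  · refine eq_of_mem_adjoin (f := (θ : F →ₐ[k] F)) (g := AlgHom.id k F) ?_ hf
    rintro a (rfl | rfl)
    exacts [θu, θv]

variable [CharZero k]

/-- The fixed field of the automorphism `x ↦ y⁻¹`, `y ↦ x` of order four. -/
theorem exists_fixed_of_order_four {x y : F} (hx : x ≠ 0) (hy : y ≠ 0)
    (h : P.bracket y x = y * x) {θ : F ≃ₐ[k] F} (hθx : θ x = y⁻¹) (hθy : θ y = x) :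
    ∃ u v : F, u ≠ 0 ∧ v ≠ 0 ∧ P.bracket v u = v * u ∧
      ∀ f, f ∈ IntermediateField.adjoin k {x, y} ∧ θ f = f ↔
        f ∈ IntermediateField.adjoin k {u, v} := by
  obtain ⟨h1, h2, h3⟩ := P.inversion_ne_zero hx hy h
  have hι := P.inversion_fixed_iff hx hy h (θ := θ.trans θ) (by simp [hθx, hθy])
    (by simp [hθx, hθy])
  obtain ⟨u, v, hu, hv, hvu, hfix⟩ := (hasLogFixedField_of_twisted_inversion (div_ne_zero h1 h2)
    (div_ne_zero h3 h2) (P.bracket_inversion hx hy h) (θ := θ)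
    (by
      rw [map_div₀, map_sub, map_sub, map_inv₀, map_inv₀, hθx, hθy, inv_div, inv_inv, ← neg_div,
        neg_sub])
    (by
      rw [map_div₀, map_sub, map_sub, map_inv₀, map_inv₀, map_mul, hθx, hθy]
      generalize hd : x - x⁻¹ = d at h1
      generalize he : y - y⁻¹ = e at h2
      generalize hc : x * y - (x * y)⁻¹ = c at h3
      field_simp
      rw [← hc, ← hd, ← he]
      field_simp
      ring)).exists_iff
  refine ⟨u, v, hu, hv, hvu, fun f => ?_⟩
  rw [← hfix, ← hι]
  simp only [AlgEquiv.trans_apply, and_assoc]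
  refine and_congr_right fun _ => ⟨fun hf => ⟨by rw [hf, hf], hf⟩, fun hf => hf.2⟩

/-- The subfield fixed by inversion and by the automorphism `y ↦ x ↦ (xy)⁻¹` of order three. -/
theorem exists_fixed_of_order_six {ω : k} (hω : IsPrimitiveRoot ω 3) {x y : F} (hx : x ≠ 0)
    (hy : y ≠ 0) (h : P.bracket y x = y * x) {ι θ : F ≃ₐ[k] F} (hιx : ι x = x⁻¹)
    (hιy : ι y = y⁻¹) (hθx : θ x = (x * y)⁻¹) (hθy : θ y = x) :
    ∃ u v : F, u ≠ 0 ∧ v ≠ 0 ∧ P.bracket v u = v * u ∧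
      ∀ f, f ∈ IntermediateField.adjoin k {x, y} ∧ ι f = f ∧ θ f = f ↔
        f ∈ IntermediateField.adjoin k {u, v} := by
  obtain ⟨h1, h2, h3⟩ := P.inversion_ne_zero hx hy h
  have hι := P.inversion_fixed_iff hx hy h hιx hιy
  have hvu := P.bracket_inversion hx hy h
  have hθu : θ ((x - x⁻¹) / (y - y⁻¹)) =
      -((x * y - (x * y)⁻¹) / (y - y⁻¹)) / ((x - x⁻¹) / (y - y⁻¹)) := by
    rw [map_div₀, map_sub, map_sub, map_inv₀, map_inv₀, hθx, hθy, inv_inv, neg_div,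
      div_div_div_cancel_right₀ h2, ← neg_div, neg_sub]
  have hθv : θ ((x * y - (x * y)⁻¹) / (y - y⁻¹)) = -((x - x⁻¹) / (y - y⁻¹))⁻¹ := by
    rw [map_div₀, map_sub, map_sub, map_inv₀, map_inv₀, map_mul, hθx, hθy, inv_div, ← neg_div,
      neg_sub]
    field_simp
  have hu0 := div_ne_zero h1 h2
  have hv0 := div_ne_zero h3 h2
  generalize (x - x⁻¹) / (y - y⁻¹) = u at *
  generalize (x * y - (x * y)⁻¹) / (y - y⁻¹) = v at *
  obtain ⟨u', v', hu, hv, hvu, hfix⟩ := (hasLogFixedField_of_order_three hω hu0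
    (div_ne_zero (neg_ne_zero.2 hv0) hu0)
    (by
      rw [bracket_div_left, map_neg, LinearMap.neg_apply, hvu, bracket_self]
      field_simp
      ring) hθu
    (by
      rw [map_div₀, map_neg, hθu, hθv]
      field_simp)).exists_iff
  refine ⟨u', v', hu, hv, hvu, fun f => ?_⟩
  have e : IntermediateField.adjoin k {u, v} = IntermediateField.adjoin k {u, -v / u} := by
    refine le_antisymm (IntermediateField.adjoin_le_iff.2 ?_) (IntermediateField.adjoin_le_iff.2 ?_)
    · have hu : u ∈ IntermediateField.adjoin k {u, -v / u} :=
        IntermediateField.subset_adjoin _ _ (by simp)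
      have hv : -v / u ∈ IntermediateField.adjoin k {u, -v / u} :=
        IntermediateField.subset_adjoin _ _ (by simp)
      rintro a (rfl | rfl)
      · exact hu
      · have hm := neg_mem (mul_mem hv hu)
        rwa [div_mul_cancel₀ _ hu0, neg_neg] at hm
    · have hu : u ∈ IntermediateField.adjoin k {u, v} :=
        IntermediateField.subset_adjoin _ _ (by simp)
      have hv : v ∈ IntermediateField.adjoin k {u, v} :=
        IntermediateField.subset_adjoin _ _ (by simp)
      rintro a (rfl | rfl)
      exacts [hu, div_mem (neg_mem hv) hu]
  rw [← hfix, ← e, ← hι, and_assoc]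

end PoissonBracket

section Monomial

open Matrix.SpecialLinearGroup

theorem zpow_monomial {F : Type*} [Field F] {x y : F} (hx : x ≠ 0) (hy : y ≠ 0)
    (a b c d p q : ℤ) :
    (y ^ a * x ^ c) ^ p * (y ^ b * x ^ d) ^ q = y ^ (a * p + b * q) * x ^ (c * p + d * q) := by
  rw [mul_zpow, mul_zpow, zpow_add₀ hy, zpow_add₀ hx, zpow_mul, zpow_mul, zpow_mul, zpow_mul]
  ring

variable {k F : Type*} [Field k] [Field F] [Algebra k F] {x y : F}
  {G : Subgroup (Matrix.SpecialLinearGroup (Fin 2) ℤ)} {σ : G → F ≃ₐ[k] F}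

/-- A monomial action is determined by its values on generators, hence is multiplicative. -/
theorem monomial_action_mul (hx : x ≠ 0) (hy : y ≠ 0)
    (hgen : IntermediateField.adjoin k {x, y} = ⊤)
    (hσy : ∀ g : G, σ g y = y ^ (g.1 0 0) * x ^ (g.1 1 0))
    (hσx : ∀ g : G, σ g x = y ^ (g.1 0 1) * x ^ (g.1 1 1)) (g h : G) (f : F) :
    σ (g * h) f = σ g (σ h f) := by
  have hf : f ∈ IntermediateField.adjoin k {x, y} := hgen ▸ IntermediateField.mem_top
  refine eq_of_mem_adjoin (f := (σ (g * h) : F →ₐ[k] F))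
    (g := ((σ h).trans (σ g) : F ≃ₐ[k] F)) ?_ hf
  rintro a (rfl | rfl)
  · change σ (g * h) a = σ g (σ h a)
    rw [hσx, hσx, map_mul, map_zpow₀, map_zpow₀, hσx, hσy, zpow_monomial hx hy]
    simp [Matrix.mul_apply, Fin.sum_univ_two]
  · change σ (g * h) a = σ g (σ h a)
    rw [hσy, hσy, map_mul, map_zpow₀, map_zpow₀, hσx, hσy, zpow_monomial hx hy]
    simp [Matrix.mul_apply, Fin.sum_univ_two]

/-- Being fixed by a group action can be checked on generators of a conjugate group. -/
theorem mem_fixedSubalgebra_iff_of_comap_conj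
    (hmul : ∀ (g h : G) (f : F), σ (g * h) f = σ g (σ h f))
    {γ : Matrix.SpecialLinearGroup (Fin 2) ℤ} {T : Set (Matrix.SpecialLinearGroup (Fin 2) ℤ)}
    (hT : G.comap (MulAut.conj γ).toMonoidHom = Subgroup.closure T) (f : F) :
    f ∈ fixedSubalgebra σ ↔ ∀ t ∈ T, ∀ ht : γ * t * γ⁻¹ ∈ G, σ ⟨γ * t * γ⁻¹, ht⟩ f = f := by
  have hmem : ∀ t, t ∈ Subgroup.closure T ↔ γ * t * γ⁻¹ ∈ G := fun t => by
    rw [← hT]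
    rfl
  have hone : σ 1 f = f := (σ 1).injective (by rw [← hmul, one_mul])
  refine ⟨fun hf t _ ht => hf _, fun hf g => ?_⟩
  have key : ∀ t (ht : t ∈ Subgroup.closure T), σ ⟨γ * t * γ⁻¹, (hmem t).1 ht⟩ f = f := by
    intro t ht
    induction ht using Subgroup.closure_induction with
    | mem t ht => exact hf t ht _
    | one =>
      have e : (⟨γ * 1 * γ⁻¹, (hmem _).1 (one_mem _)⟩ : G) = 1 := by
        ext1
        simp
      rw [e, hone]
    | mul s t hs ht ihs iht =>
      have e : (⟨γ * (s * t) * γ⁻¹, (hmem _).1 (mul_mem hs ht)⟩ : G) =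
          ⟨γ * s * γ⁻¹, (hmem s).1 hs⟩ * ⟨γ * t * γ⁻¹, (hmem t).1 ht⟩ := by
        ext1
        simp [mul_assoc]
      rw [e, hmul, iht, ihs]
    | inv t ht ih =>
      have e : (⟨γ * t⁻¹ * γ⁻¹, (hmem _).1 (inv_mem ht)⟩ : G) *
          ⟨γ * t * γ⁻¹, (hmem t).1 ht⟩ = 1 := by
        ext1
        simp [mul_assoc]
      rw [← ih, ← hmul, e, hone, ih]
  have hg : γ⁻¹ * g.1 * γ ∈ Subgroup.closure T := (hmem _).2 (by simp [mul_assoc])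
  have := key _ hg
  simpa [mul_assoc] using this

end Monomial

/-- Let `k` be a field of characteristic zero containing a primitive third
root of unity, let `F = k(x,y)` (a field generated over `k` by two algebraically independent
elements `x, y`) carry the Poisson bracket with `{y,x} = yx`, and let a finite subgroup `G` of
`SL₂(ℤ)` act on `F` by Poisson monomial automorphisms
`σ_g(y) = yᵃxᶜ`, `σ_g(x) = yᵇxᵈ` for `g = [[a,b],[c,d]] ∈ G`.  Then the fixed field `F^G`
is Poisson-isomorphic to `F`: there is a `k`-algebra isomorphism `F^G → F` respecting the
Poisson brackets. -/
theorem statement0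
    (k : Type*) [Field k] [CharZero k] (ω : k) (hω : IsPrimitiveRoot ω 3)
    (F : Type*) [Field F] [Algebra k F] (x y : F)
    (hind : AlgebraicIndependent k ![x, y])
    (hgen : IntermediateField.adjoin k {x, y} = ⊤)
    (P : PoissonBracket k F) (hP : P.bracket y x = y * x)
    (G : Subgroup (Matrix.SpecialLinearGroup (Fin 2) ℤ)) [Finite G]
    (σ : G → F ≃ₐ[k] F)
    (hσy : ∀ g : G, σ g y =
      y ^ ((g : Matrix.SpecialLinearGroup (Fin 2) ℤ) 0 0) *
        x ^ ((g : Matrix.SpecialLinearGroup (Fin 2) ℤ) 1 0))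
    (hσx : ∀ g : G, σ g x =
      y ^ ((g : Matrix.SpecialLinearGroup (Fin 2) ℤ) 0 1) *
        x ^ ((g : Matrix.SpecialLinearGroup (Fin 2) ℤ) 1 1))
    (hσP : ∀ (g : G) (a b : F), σ g (P.bracket a b) = P.bracket (σ g a) (σ g b)) :
    ∃ e : ↥(fixedSubalgebra σ) ≃ₐ[k] F,
      ∀ (a b : ↥(fixedSubalgebra σ)) (hab : P.bracket (a : F) (b : F) ∈ fixedSubalgebra σ),
        e ⟨P.bracket (a : F) (b : F), hab⟩ = P.bracket (e a) (e b) := by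
  have hx : x ≠ 0 := hind.ne_zero 0
  have hy : y ≠ 0 := hind.ne_zero 1
  obtain ⟨γ, T, hTmem, hT⟩ := exists_comap_conj_eq G
  obtain ⟨X, hX⟩ : ∃ X, X = y ^ (γ 0 1) * x ^ (γ 1 1) := ⟨_, rfl⟩
  obtain ⟨Y, hY⟩ : ∃ Y, Y = y ^ (γ 0 0) * x ^ (γ 1 0) := ⟨_, rfl⟩
  have hX0 : X ≠ 0 := hX ▸ mul_ne_zero (zpow_ne_zero _ hy) (zpow_ne_zero _ hx)
  have hY0 : Y ≠ 0 := hY ▸ mul_ne_zero (zpow_ne_zero _ hy) (zpow_ne_zero _ hx)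
  have hYX : P.bracket Y X = Y * X := by
    have hdet := γ.det_coe
    rw [Matrix.det_fin_two] at hdet
    rw [hX, hY, P.bracket_monomial hx hy hP, hdet, Int.cast_one, one_mul]
  have hXY : ∀ p q : ℤ, Y ^ p * X ^ q =
      y ^ (γ 0 0 * p + γ 0 1 * q) * x ^ (γ 1 0 * p + γ 1 1 * q) := fun p q => by
    rw [hX, hY, zpow_monomial hx hy]
  have hgen' : IntermediateField.adjoin k {X, Y} = ⊤ := by
    rw [← top_le_iff, ← hgen, IntermediateField.adjoin_le_iff]
    have hmem : ∀ p q : ℤ, Y ^ p * X ^ q ∈ IntermediateField.adjoin k {X, Y} := fun p q =>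
      mul_mem (zpow_mem (IntermediateField.subset_adjoin _ _ (by simp)) _)
        (zpow_mem (IntermediateField.subset_adjoin _ _ (by simp)) _)
    have hinv : ∀ i j, (γ * γ⁻¹) i j = (1 : Matrix.SpecialLinearGroup (Fin 2) ℤ) i j :=
      fun i j => by rw [mul_inv_cancel]
    simp only [Matrix.SpecialLinearGroup.coe_mul, Matrix.mul_apply, Fin.sum_univ_two] at hinv
    rintro a (rfl | rfl)
    · have := hmem (γ⁻¹ 0 1) (γ⁻¹ 1 1)
      rw [hXY, hinv, hinv] at this
      simpa using this
    · have := hmem (γ⁻¹ 0 0) (γ⁻¹ 1 0)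
      rw [hXY, hinv, hinv] at this
      simpa using this
  have htop : ∀ f : F, f ∈ IntermediateField.adjoin k {X, Y} := fun f =>
    hgen' ▸ IntermediateField.mem_top
  have hconj : ∀ t (ht : γ * t * γ⁻¹ ∈ G),
      σ ⟨γ * t * γ⁻¹, ht⟩ Y = Y ^ (t 0 0) * X ^ (t 1 0) ∧
        σ ⟨γ * t * γ⁻¹, ht⟩ X = Y ^ (t 0 1) * X ^ (t 1 1) := by
    intro t ht
    obtain ⟨g, hg⟩ : ∃ g, γ * t * γ⁻¹ = g := ⟨_, rfl⟩
    have e : ∀ i j, (γ * t) i j = (g * γ) i j := fun i j => by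
      rw [← hg, inv_mul_cancel_right]
    simp only [Matrix.SpecialLinearGroup.coe_mul, Matrix.mul_apply, Fin.sum_univ_two] at e
    simp only [hg] at ht ⊢
    constructor
    · rw [hXY, e, e, hY, map_mul, map_zpow₀, map_zpow₀, hσx, hσy, zpow_monomial hx hy]
    · rw [hXY, e, e, hX, map_mul, map_zpow₀, map_zpow₀, hσx, hσy, zpow_monomial hx hy]
  have hfix := mem_fixedSubalgebra_iff_of_comap_conj
    (monomial_action_mul hx hy hgen hσy hσx) hT
  have hTG : ∀ t ∈ T, γ * t * γ⁻¹ ∈ G := fun t ht => by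
    have : t ∈ G.comap (MulAut.conj γ).toMonoidHom := hT ▸ Subgroup.subset_closure ht
    exact this
  suffices H : ∃ u v : F, u ≠ 0 ∧ v ≠ 0 ∧ P.bracket v u = v * u ∧
      ∀ f, f ∈ fixedSubalgebra σ ↔ f ∈ IntermediateField.adjoin k {u, v} by
    obtain ⟨u, v, hu, hv, hvu, H⟩ := H
    exact P.exists_algEquiv hgen hx hy hP hu hv hvu H
  have single : ∀ t (ht : γ * t * γ⁻¹ ∈ G), T = {t} → ∀ f,
      f ∈ fixedSubalgebra σ ↔ f ∈ IntermediateField.adjoin k {X, Y} ∧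
        σ ⟨γ * t * γ⁻¹, ht⟩ f = f := fun t ht hTt f => by
    rw [hfix, hTt]
    simp [htop, ht]
  simp only [standardGenerators, Set.mem_insert_iff, Set.mem_singleton_iff] at hTmem
  rcases hTmem with h | h | h | h | h
  · exact ⟨X, Y, hX0, hY0, hYX, fun f => by simp [hfix, h, htop]⟩
  · have ht := hTG (-1) (by simp [h])
    obtain ⟨h1, h2, h3⟩ := P.inversion_ne_zero hX0 hY0 hYX
    refine ⟨_, _, div_ne_zero h1 h2, div_ne_zero h3 h2, P.bracket_inversion hX0 hY0 hYX,
      fun f => ?_⟩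
    rw [single _ ht h, P.inversion_fixed_iff hX0 hY0 hYX]
    · simpa using (hconj _ ht).2
    · simpa using (hconj _ ht).1
  · have ht := hTG ModularGroup.S (by simp [h])
    simp only [single _ ht h]
    refine PoissonBracket.exists_fixed_of_order_four hX0 hY0 hYX ?_ ?_
    · simpa [ModularGroup.S] using (hconj _ ht).2
    · simpa [ModularGroup.S] using (hconj _ ht).1
  · have ht := hTG orderThree (by simp [h])
    simp only [single _ ht h]
    refine (PoissonBracket.hasLogFixedField_of_order_three hω hX0 hY0 hYX ?_ ?_).exists_iff
    · simpa [orderThree] using (hconj _ ht).2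
    · simpa [orderThree] using (hconj _ ht).1
  · have ht1 := hTG (-1) (by simp [h])
    have ht2 := hTG (orderThree ^ 2) (by simp [h])
    obtain ⟨u, v, hu, hv, hvu, H⟩ := PoissonBracket.exists_fixed_of_order_six hω hX0 hY0 hYX
      (ι := σ ⟨_, ht1⟩) (θ := σ ⟨_, ht2⟩) (by simpa using (hconj _ ht1).2)
      (by simpa using (hconj _ ht1).1)
      (by
        have h2 := (hconj _ ht2).2
        rw [show (orderThree ^ 2) 0 1 = -1 from rfl, show (orderThree ^ 2) 1 1 = -1 from rfl] at h2
        rw [h2, zpow_neg_one, zpow_neg_one, mul_inv, mul_comm])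
      (by
        have h2 := (hconj _ ht2).1
        rw [show (orderThree ^ 2) 0 0 = 0 from rfl, show (orderThree ^ 2) 1 0 = 1 from rfl] at h2
        rw [h2, zpow_zero, zpow_one, one_mul])
    refine ⟨u, v, hu, hv, hvu, fun f => ?_⟩
    rw [← H, hfix, h]
    simp only [Set.forall_mem_insert, Set.mem_singleton_iff, forall_eq, htop, true_and, ht1, ht2,
      forall_true_left]
end
end

section
/- Let k be a field of characteristic zero and let φ be the k-algebra automorphism of F = k(x,y) determined by φ(x) = −x^{-1} and φ(y) = (x^{-1} − x)y^{-1}. Then φ is a Poisson automorphism of F of order 2. Moreover, setting f = (x² + xy² − 1)²·x / ((x²y² − x² − 2x − 1)(x²y² + x² − 2x + 1)) and g = (x² + 1)y / (x² + xy² − 1), the elements f and g are fixed by φ, they satisfy {g,f} = gf, and the subfield k(f,g) of F generated by f and g over k equals the fixed field F^φ. -/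
noncomputable section

namespace PoissonBracket

variable {k R : Type*} [CommRing k] [CommRing R] [Algebra k R]

/-- Bracketing with a fixed element on the left, as a derivation. -/
def derivation (P : PoissonBracket k R) (a : R) : Derivation k R R :=
  Derivation.mk' (P.bracket a) fun b c => by
    rw [P.leibniz, smul_eq_mul, smul_eq_mul]; ring

@[simp]
theorem derivation_apply (P : PoissonBracket k R) (a b : R) :
    P.derivation a b = P.bracket a b := rfl

/-- The pullback of a Poisson bracket along an automorphism. -/
def pullback (P : PoissonBracket k R) (φ : R ≃ₐ[k] R) : PoissonBracket k R where
  bracket := (P.bracket.compl₁₂ φ.toLinearMap φ.toLinearMap).compr₂ φ.symm.toLinearMap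
  antisymm a b := by
    simp only [LinearMap.compr₂_apply, LinearMap.compl₁₂_apply, AlgEquiv.toLinearMap_apply]
    rw [P.antisymm, map_neg]
  jacobi a b c := by
    simp only [LinearMap.compr₂_apply, LinearMap.compl₁₂_apply, AlgEquiv.toLinearMap_apply,
      AlgEquiv.apply_symm_apply]
    rw [← map_add, ← map_add, P.jacobi, map_zero]
  leibniz a b c := by
    simp only [LinearMap.compr₂_apply, LinearMap.compl₁₂_apply, AlgEquiv.toLinearMap_apply]
    rw [map_mul, P.leibniz]
    simp

theorem pullback_bracket (P : PoissonBracket k R) (φ : R ≃ₐ[k] R) (a b : R) :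
    (P.pullback φ).bracket a b = φ.symm (P.bracket (φ a) (φ b)) := rfl

end PoissonBracket

section Field

variable {k F : Type*} [Field k] [Field F] [Algebra k F]

/-- Derivations that agree on a set of field generators are equal. -/
theorem Derivation.ext_of_intermediateField_adjoin_eq_top {S : Set F}
    (hS : IntermediateField.adjoin k S = ⊤) {D E : Derivation k F F}
    (h : ∀ s ∈ S, D s = E s) : D = E := by
  ext t
  have ht : t ∈ IntermediateField.adjoin k S := hS ▸ IntermediateField.mem_top
  induction ht using IntermediateField.adjoin_induction with
  | mem s hs => exact h s hs
  | algebraMap r => simp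
  | add a b _ _ ha hb => rw [map_add, map_add, ha, hb]
  | inv a _ ha => rw [Derivation.leibniz_inv, Derivation.leibniz_inv, ha]
  | mul a b _ _ ha hb => rw [Derivation.leibniz, Derivation.leibniz, ha, hb]

theorem PoissonBracket.bracket_self_s5 [CharZero k] (P : PoissonBracket k F) (a : F) :
    P.bracket a a = 0 := by
  have : CharZero F := charZero_of_injective_algebraMap (algebraMap k F).injective
  exact self_eq_neg.mp (P.antisymm a a)

/-- A Poisson bracket on a field generated by two elements is determined by their bracket. -/
theorem PoissonBracket.bracket_eq_of_adjoin_pair_eq_top [CharZero k] {x y : F}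
    (hgen : IntermediateField.adjoin k {x, y} = ⊤) {P Q : PoissonBracket k F}
    (h : P.bracket y x = Q.bracket y x) (a b : F) : P.bracket a b = Q.bracket a b := by
  have hx : P.derivation x = Q.derivation x := by
    refine Derivation.ext_of_intermediateField_adjoin_eq_top hgen ?_
    rintro s (rfl | rfl)
    · simp [bracket_self_s5]
    · simp only [derivation_apply]
      rw [P.antisymm, Q.antisymm, h]
  have hy : P.derivation y = Q.derivation y := by
    refine Derivation.ext_of_intermediateField_adjoin_eq_top hgen ?_
    rintro s (rfl | rfl)
    · exact h
    · simp [bracket_self_s5]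
  suffices P.derivation a = Q.derivation a from DFunLike.congr_fun this b
  refine Derivation.ext_of_intermediateField_adjoin_eq_top hgen ?_
  rintro s (rfl | rfl)
  · simp only [derivation_apply]
    rw [P.antisymm, Q.antisymm]
    exact congrArg Neg.neg (DFunLike.congr_fun hx a)
  · simp only [derivation_apply]
    rw [P.antisymm, Q.antisymm]
    exact congrArg Neg.neg (DFunLike.congr_fun hy a)

/-- An automorphism fixing field generators fixes everything they generate. -/
theorem AlgEquiv.apply_eq_self_of_mem_adjoin {φ : F ≃ₐ[k] F} {S : Set F}
    (h : ∀ s ∈ S, φ s = s) {t : F} (ht : t ∈ IntermediateField.adjoin k S) : φ t = t := by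
  induction ht using IntermediateField.adjoin_induction with
  | mem s hs => exact h s hs
  | algebraMap r => simp
  | add a b _ _ ha hb => rw [map_add, ha, hb]
  | inv a _ ha => rw [map_inv₀, ha]
  | mul a b _ _ ha hb => rw [map_mul, ha, hb]

/-- If `x` is a root of `X ^ 2 - s X - 1` with `s` in a subfield `K` fixed by `φ`, and `φ x` is
the conjugate root, then the field generated by elements of `K + K x` is contained in `K + K x`. -/
theorem exists_add_mul_eq_of_mem_adjoin {φ : F ≃ₐ[k] F} {K : IntermediateField k F}
    (hK : ∀ a ∈ K, φ a = a) {x s : F} (hs : s ∈ K) (hφ : φ x = s - x)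
    (hx : x ^ 2 = s * x + 1) {S : Set F}
    (hS : ∀ t ∈ S, ∃ a ∈ K, ∃ b ∈ K, t = a + b * x) {t : F}
    (ht : t ∈ IntermediateField.adjoin k S) : ∃ a ∈ K, ∃ b ∈ K, t = a + b * x := by
  induction ht using IntermediateField.adjoin_induction with
  | mem s hs => exact hS s hs
  | algebraMap r => exact ⟨_, K.algebraMap_mem r, 0, K.zero_mem, by simp⟩
  | add u v _ _ hu hv =>
    obtain ⟨a, ha, b, hb, rfl⟩ := hu
    obtain ⟨c, hc, d, hd, rfl⟩ := hv
    exact ⟨a + c, add_mem ha hc, b + d, add_mem hb hd, by ring⟩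
  | inv u _ hu =>
    obtain ⟨a, ha, b, hb, rfl⟩ := hu
    by_cases h0 : a + b * x = 0
    · exact ⟨0, K.zero_mem, 0, K.zero_mem, by simp [h0]⟩
    have h1 : a + b * (s - x) ≠ 0 := by
      rw [← hφ]
      nth_rewrite 1 [← hK a ha, ← hK b hb]
      rw [← map_mul, ← map_add]
      exact (map_ne_zero φ).mpr h0
    have hn : (a + b * x) * (a + b * (s - x)) = a ^ 2 + a * b * s - b ^ 2 := by
      linear_combination (-b ^ 2) * hx
    have hN : a ^ 2 + a * b * s - b ^ 2 ∈ K :=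
      sub_mem (add_mem (pow_mem ha 2) (mul_mem (mul_mem ha hb) hs)) (pow_mem hb 2)
    refine ⟨(a + b * s) / (a ^ 2 + a * b * s - b ^ 2),
      div_mem (add_mem ha (mul_mem hb hs)) hN,
      -b / (a ^ 2 + a * b * s - b ^ 2), div_mem (neg_mem hb) hN, ?_⟩
    rw [← hn]
    field_simp
    ring
  | mul u v _ _ hu hv =>
    obtain ⟨a, ha, b, hb, rfl⟩ := hu
    obtain ⟨c, hc, d, hd, rfl⟩ := hv
    refine ⟨a * c + b * d, add_mem (mul_mem ha hc) (mul_mem hb hd), a * d + b * c + b * d * s,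
      add_mem (add_mem (mul_mem ha hd) (mul_mem hb hc)) (mul_mem (mul_mem hb hd) hs), ?_⟩
    linear_combination (b * d) * hx

/-- A polynomial that does not vanish at some point does not vanish at algebraically
independent elements. -/
theorem AlgebraicIndependent.aeval_ne_zero_of_eval_ne_zero {ι : Type*} {v : ι → F}
    (hv : AlgebraicIndependent k v) {p : MvPolynomial ι k} (w : ι → k)
    (h : MvPolynomial.eval w p ≠ 0) : MvPolynomial.aeval v p ≠ 0 := fun h0 =>
  h (by rw [hv.eq_zero_of_aeval_eq_zero p h0, map_zero])

open MvPolynomial in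
/-- The factors of the numerators and denominators of `f` and `g`, and of `1 - g ^ 4`, are
nonzero. -/
theorem ne_zero_of_algebraicIndependent [CharZero k] {x y : F}
    (hind : AlgebraicIndependent k ![x, y]) :
    x ≠ 0 ∧ y ≠ 0 ∧ x ^ 2 + 1 ≠ 0 ∧ x ^ 2 - 1 ≠ 0 ∧ x ^ 2 + x * y ^ 2 - 1 ≠ 0 ∧
      x ^ 2 * y ^ 2 - x ^ 2 - 2 * x - 1 ≠ 0 ∧ x ^ 2 * y ^ 2 + x ^ 2 - 2 * x + 1 ≠ 0 ∧
      y ^ 2 - (x - 1) ^ 2 ≠ 0 ∧ y ^ 2 + (x + 1) ^ 2 ≠ 0 := by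
  have key (p : MvPolynomial (Fin 2) k) {z : F} (hz : aeval ![x, y] p = z)
      (h : eval ![2, 3] p ≠ 0) : z ≠ 0 :=
    hz ▸ hind.aeval_ne_zero_of_eval_ne_zero _ h
  refine ⟨?_, ?_, ?_, ?_, ?_, ?_, ?_, ?_, ?_⟩
  · exact key (X 0) (by simp) (by norm_num)
  · exact key (X 1) (by simp) (by norm_num)
  · exact key (X 0 ^ 2 + 1) (by simp) (by norm_num)
  · exact key (X 0 ^ 2 - 1) (by simp) (by norm_num)
  · exact key (X 0 ^ 2 + X 0 * X 1 ^ 2 - 1) (by simp) (by norm_num)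
  · exact key (X 0 ^ 2 * X 1 ^ 2 - X 0 ^ 2 - 2 * X 0 - 1) (by simp) (by norm_num)
  · exact key (X 0 ^ 2 * X 1 ^ 2 + X 0 ^ 2 - 2 * X 0 + 1) (by simp) (by norm_num)
  · exact key (X 1 ^ 2 - (X 0 - 1) ^ 2) (by simp) (by norm_num)
  · exact key (X 1 ^ 2 + (X 0 + 1) ^ 2) (by simp) (by norm_num)

end Field

/-- Let `k` be a field of characteristic zero, let `F = k(x,y)` carry the
Poisson bracket with `{y,x} = yx`, and let `φ` be the `k`-algebra automorphism of `F`
determined by `φ(x) = −x⁻¹` and `φ(y) = (x⁻¹ − x)y⁻¹`.  Then `φ` is a Poisson automorphism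
of order 2; moreover, with
`f = (x² + xy² − 1)²·x / ((x²y² − x² − 2x − 1)(x²y² + x² − 2x + 1))` and
`g = (x² + 1)y / (x² + xy² − 1)`, the elements `f, g` are fixed by `φ`, satisfy `{g,f} = gf`,
and the subfield `k(f,g)` equals the fixed field `F^φ`. -/
theorem statement5
    (k : Type*) [Field k] [CharZero k]
    (F : Type*) [Field F] [Algebra k F] (x y : F)
    (hind : AlgebraicIndependent k ![x, y])
    (hgen : IntermediateField.adjoin k {x, y} = ⊤)
    (P : PoissonBracket k F) (hP : P.bracket y x = y * x)
    (φ : F ≃ₐ[k] F) (hφx : φ x = -x⁻¹) (hφy : φ y = (x⁻¹ - x) * y⁻¹)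
    (f g : F)
    (hf : f = (x ^ 2 + x * y ^ 2 - 1) ^ 2 * x /
      ((x ^ 2 * y ^ 2 - x ^ 2 - 2 * x - 1) * (x ^ 2 * y ^ 2 + x ^ 2 - 2 * x + 1)))
    (hg : g = (x ^ 2 + 1) * y / (x ^ 2 + x * y ^ 2 - 1)) :
    (∀ a b : F, φ (P.bracket a b) = P.bracket (φ a) (φ b)) ∧
      orderOf φ = 2 ∧
      φ f = f ∧ φ g = g ∧ P.bracket g f = g * f ∧
      (∀ t : F, t ∈ IntermediateField.adjoin k {f, g} ↔ φ t = t) := by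
  obtain ⟨hx, hy, hxp, hxm, hW, hD₁, hD₂, hE₁, hE₂⟩ := ne_zero_of_algebraicIndependent hind
  have hgW : g * (x ^ 2 + x * y ^ 2 - 1) = (x ^ 2 + 1) * y := by
    rw [hg, div_mul_cancel₀ _ hW]
  have hg0 : g ≠ 0 := by rw [hg]; exact div_ne_zero (mul_ne_zero hxp hy) hW
  have hfactor : (1 - g ^ 4) * (x ^ 2 + x * y ^ 2 - 1) ^ 4 =
      (x ^ 2 * y ^ 2 - x ^ 2 - 2 * x - 1) * (x ^ 2 * y ^ 2 + x ^ 2 - 2 * x + 1) *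
        ((y ^ 2 - (x - 1) ^ 2) * (y ^ 2 + (x + 1) ^ 2)) := by
    rw [sub_mul, ← mul_pow, hgW]; ring
  have hg4 : 1 - g ^ 4 ≠ 0 := by
    intro h
    rw [h, zero_mul] at hfactor
    exact mul_ne_zero (mul_ne_zero hD₁ hD₂) (mul_ne_zero hE₁ hE₂) hfactor.symm
  have hf0 : f ≠ 0 := by
    rw [hf]
    exact div_ne_zero (mul_ne_zero (pow_ne_zero 2 hW) hx) (mul_ne_zero hD₁ hD₂)
  -- `g * y - x` is a polynomial in `f` and `g`
  have hA : f * (1 - g ^ 4) = g ^ 2 + (g * y - x) := by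
    rw [hf, div_mul_eq_mul_div, div_eq_iff (mul_ne_zero hD₁ hD₂)]
    refine mul_right_cancel₀ (pow_ne_zero 4 hW) ?_
    have e : (g ^ 2 + (g * y - x)) * (x ^ 2 + x * y ^ 2 - 1) ^ 2 =
        ((x ^ 2 + 1) * y) ^ 2 + ((x ^ 2 + 1) * y * y * (x ^ 2 + x * y ^ 2 - 1)
          - x * (x ^ 2 + x * y ^ 2 - 1) ^ 2) := by
      rw [← hgW]; ring
    linear_combination ((x ^ 2 + x * y ^ 2 - 1) ^ 2 * x) * hfactor -
      (x ^ 2 * y ^ 2 - x ^ 2 - 2 * x - 1) * (x ^ 2 * y ^ 2 + x ^ 2 - 2 * x + 1) *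
        (x ^ 2 + x * y ^ 2 - 1) ^ 2 * e
  have hφy' : φ y = (1 - x ^ 2) / (x * y) := by rw [hφy]; field_simp
  have hφW : φ (x ^ 2 + x * y ^ 2 - 1) =
      (1 - x ^ 2) / (x ^ 3 * y ^ 2) * (x ^ 2 + x * y ^ 2 - 1) := by
    simp only [map_sub, map_add, map_mul, map_pow, map_one, hφx, hφy']
    field_simp
    ring
  have h1x : 1 - x ^ 2 ≠ 0 := by rwa [← neg_sub, neg_ne_zero]
  have hφg : φ g = g := by
    refine mul_right_cancel₀ ((map_ne_zero φ).mpr hW) ?_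
    rw [← map_mul, hgW, hφW, mul_left_comm, hgW]
    simp only [map_add, map_mul, map_pow, map_one, hφx, hφy']
    field_simp
    ring
  have hs : φ x = (x - x⁻¹) - x := by rw [hφx]; ring
  have hφA : φ (g * y - x) = g * y - x := by
    rw [map_sub, map_mul, hφg, hφx, hφy']
    field_simp
    linear_combination -hgW
  have hφf : φ f = f := by
    refine mul_right_cancel₀ hg4 ?_
    calc φ f * (1 - g ^ 4) = φ (f * (1 - g ^ 4)) := by
          rw [map_mul, map_sub, map_pow, hφg, map_one]
      _ = f * (1 - g ^ 4) := by rw [hA, map_add, hφA, map_pow, hφg]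
  have hφxx : φ (φ x) = x := by rw [hφx, map_neg, map_inv₀, hφx]; simp
  have hφyy : φ (φ y) = y := by
    rw [hφy, map_mul, map_sub, map_inv₀, map_inv₀, hφx, hφy']
    field_simp
    ring
  have hxy : P.bracket x y = -(y * x) := by rw [P.antisymm, hP]
  have hxx := P.bracket_self_s5 x
  have hyy := P.bracket_self_s5 y
  refine ⟨fun a b => ?_, ?_, hφf, hφg, ?_, fun t => ⟨fun ht => ?_, fun ht => ?_⟩⟩
  · have h : P.bracket y x = (P.pullback φ).bracket y x := by
      rw [P.pullback_bracket, AlgEquiv.eq_symm_apply, hP, map_mul, hφx, hφy, map_neg]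
      have e₁ (c : F) : P.bracket c x⁻¹ = -(x⁻¹ ^ 2 * P.bracket c x) := by
        simpa using (P.derivation c).leibniz_inv x
      have e₂ (c : F) : P.bracket c y⁻¹ = -(y⁻¹ ^ 2 * P.bracket c y) := by
        simpa using (P.derivation c).leibniz_inv y
      rw [e₁, P.antisymm, P.leibniz, map_sub, e₁, e₂, hxx, hxy]
      field_simp
      ring
    rw [P.bracket_eq_of_adjoin_pair_eq_top hgen h, P.pullback_bracket, φ.apply_symm_apply]
  · refine orderOf_eq_prime ?_ fun h => ?_
    · ext t
      refine AlgEquiv.apply_eq_self_of_mem_adjoin (S := {x, y}) ?_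
        (hgen ▸ IntermediateField.mem_top)
      rintro s (rfl | rfl)
      · simpa [pow_two] using hφxx
      · simpa [pow_two] using hφyy
    · rw [h, AlgEquiv.one_apply] at hφx
      apply hxp
      field_simp at hφx
      linear_combination hφx
  · have e (c : F) := congrArg (P.derivation c) hgW
    have ex := e x
    have ey := e y
    have eg := congrArg (P.derivation g) hA
    simp only [Derivation.leibniz, Derivation.leibniz_pow, map_add, map_sub,
      Derivation.map_one_eq_zero, PoissonBracket.derivation_apply, smul_eq_mul, nsmul_eq_mul,
      hxx, hyy, hP, hxy, P.bracket_self_s5 g, P.antisymm x g, P.antisymm y g] at ex ey eg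
    push_cast at ex ey eg
    refine mul_left_cancel₀ (mul_ne_zero hW hg4) ?_
    linear_combination (x ^ 2 + x * y ^ 2 - 1) * eg - (x ^ 2 + x * y ^ 2 - 1) * g * hA - g * ey +
      ex + (x - g ^ 2) * hgW
  · refine AlgEquiv.apply_eq_self_of_mem_adjoin ?_ ht
    rintro s (rfl | rfl)
    exacts [hφf, hφg]
  · set K := IntermediateField.adjoin k {f, g} with hKdef
    have hfK : f ∈ K := IntermediateField.subset_adjoin k _ (by simp)
    have hgK : g ∈ K := IntermediateField.subset_adjoin k _ (by simp)
    have hAK : g * y - x ∈ K := by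
      have : g * y - x = f * (1 - g ^ 4) - g ^ 2 := by rw [hA]; ring
      rw [this]
      exact sub_mem (mul_mem hfK (sub_mem K.one_mem (pow_mem hgK 4))) (pow_mem hgK 2)
    have hK : ∀ a ∈ K, φ a = a := fun a ha => by
      refine AlgEquiv.apply_eq_self_of_mem_adjoin ?_ ha
      rintro s (rfl | rfl)
      exacts [hφf, hφg]
    have hsK : x - x⁻¹ ∈ K := by
      have : x - x⁻¹ = (1 - (g * y - x) ^ 2) / (f * (1 - g ^ 4)) := by
        rw [eq_div_iff (mul_ne_zero hf0 hg4), hA]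
        field_simp
        linear_combination g * hgW
      rw [this]
      exact div_mem (sub_mem K.one_mem (pow_mem hAK 2))
        (mul_mem hfK (sub_mem K.one_mem (pow_mem hgK 4)))
    obtain ⟨a, ha, b, hb, rfl⟩ := exists_add_mul_eq_of_mem_adjoin hK hsK hs
      (by field_simp; ring) (S := {x, y}) (t := t) (by
        rintro s (rfl | rfl)
        · exact ⟨0, K.zero_mem, 1, K.one_mem, by simp⟩
        · exact ⟨(g * s - x) / g, div_mem hAK hgK, g⁻¹, inv_mem hgK, by field_simp; ring⟩)
      (hgen ▸ IntermediateField.mem_top)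
    have hb0 : b = 0 := by
      rw [map_add, map_mul, hK a ha, hK b hb, hφx] at ht
      have : b * (x ^ 2 + 1) = 0 := by
        field_simp at ht
        linear_combination -ht
      exact (mul_eq_zero.mp this).resolve_right hxp
    simpa [hb0] using ha
end
end

section
/- Let K be a field, α a ring automorphism of K, and (a_i)_{i≥0} a sequence in K. Then the following are equivalent: (i) there exist an integer n ≥ 1 and constants c_1, …, c_n ∈ K (some of which may be zero) such that a_{i+n} = c_1·α(a_{i+n−1}) + c_2·α²(a_{i+n−2}) + ⋯ + c_n·α^n(a_i) for every i ≥ 0; (ii) there exists an integer m ≥ 1 such that det(Δ_k) = 0 for every k ≥ m. -/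
noncomputable section

/-- The `p × p` matrix with `(r, s)`-entry `β ^ s (a (r + s))`. -/
def twistedHankel {K : Type*} [Field K] (β : RingAut K) (a : ℕ → K) (p : ℕ) :
    Matrix (Fin p) (Fin p) K :=
  Matrix.of fun r s => (β ^ (s : ℕ)) (a ((r : ℕ) + (s : ℕ)))

/-- Column `m` of the infinite twisted Hankel matrix is the combination of the previous columns
with coefficients `c`. -/
def IsColumnRelation {K : Type*} [Field K] (β : RingAut K) (a : ℕ → K) (m : ℕ) (c : ℕ → K) :
    Prop :=
  ∀ i : ℕ, (β ^ m) (a (i + m)) = ∑ j ∈ Finset.range m, c j * (β ^ j) (a (i + j))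

section

variable {K : Type*} [Field K]

theorem RingAut.iterate_eq_pow_apply (α : RingAut K) (j : ℕ) (x : K) :
    (⇑α)^[j] x = (α ^ j) x := by
  induction j with
  | zero => rfl
  | succ j ih => rw [Function.iterate_succ_apply', ih, pow_succ', RingAut.mul_apply]

theorem RingAut.pow_apply_inv_pow_apply (α : RingAut K) {s k : ℕ} (h : s ≤ k) (x : K) :
    (α ^ k) ((α⁻¹ ^ s) x) = (α ^ (k - s)) x := by
  rw [← RingAut.mul_apply, inv_pow, ← pow_sub α h]

theorem RingAut.inv_pow_apply_pow_apply (α : RingAut K) {s k : ℕ} (h : s ≤ k) (x : K) :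
    (α⁻¹ ^ k) ((α ^ s) x) = (α⁻¹ ^ (k - s)) x := by
  simpa using RingAut.pow_apply_inv_pow_apply α⁻¹ h x

theorem det_eq_zero_iff_det_twistedHankel_eq_zero (α : RingAut K) (a : ℕ → K) (k : ℕ) :
    (Matrix.of fun r s : Fin (k + 1) =>
        (⇑α)^[k - (s : ℕ)] (a ((r : ℕ) + (s : ℕ)))).det = 0 ↔
      (twistedHankel α⁻¹ a (k + 1)).det = 0 := by
  have h : (Matrix.of fun r s : Fin (k + 1) =>
      (⇑α)^[k - (s : ℕ)] (a ((r : ℕ) + (s : ℕ)))) =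
      (α ^ k : K ≃+* K).mapMatrix (twistedHankel α⁻¹ a (k + 1)) := by
    ext r s
    simp only [Matrix.of_apply, RingEquiv.mapMatrix_apply, Matrix.map_apply, twistedHankel]
    rw [RingAut.pow_apply_inv_pow_apply α (by omega), RingAut.iterate_eq_pow_apply]
  rw [h, ← RingEquiv.map_det]
  exact EmbeddingLike.map_eq_zero_iff

theorem exists_recurrence_iff_exists_isColumnRelation (α : RingAut K) (a : ℕ → K) (n : ℕ) :
    (∃ c : Fin n → K, ∀ i : ℕ,
        a (i + n) = ∑ j : Fin n, c j * (⇑α)^[(j : ℕ) + 1] (a (i + n - ((j : ℕ) + 1)))) ↔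
      ∃ c, IsColumnRelation α⁻¹ a n c := by
  have key : ∀ (c : Fin n → K) (d : ℕ → K), (∀ j : Fin n, d (j.rev : ℕ) = (α⁻¹ ^ n) (c j)) →
      ∀ i : ℕ, (a (i + n) =
          ∑ j : Fin n, c j * (⇑α)^[(j : ℕ) + 1] (a (i + n - ((j : ℕ) + 1)))) ↔
        (α⁻¹ ^ n) (a (i + n)) = ∑ j ∈ Finset.range n, d j * (α⁻¹ ^ j) (a (i + j)) := by
    intro c d hcd i
    rw [← (α⁻¹ ^ n : RingAut K).injective.eq_iff, map_sum,
      Finset.sum_range (fun j => d j * (α⁻¹ ^ j) (a (i + j))),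
      ← Equiv.sum_comp Fin.revPerm (fun j : Fin n => d j * (α⁻¹ ^ (j : ℕ)) (a (i + j)))]
    refine Eq.congr_right (Finset.sum_congr rfl fun j _ => ?_)
    rw [Fin.revPerm_apply, hcd, map_mul, RingAut.iterate_eq_pow_apply,
      RingAut.inv_pow_apply_pow_apply α (by omega), Fin.val_rev,
      Nat.add_sub_assoc (by omega)]
  constructor
  · rintro ⟨c, hc⟩
    refine ⟨fun s => if h : s < n then (α⁻¹ ^ n) (c (Fin.rev ⟨s, h⟩)) else 0, fun i => ?_⟩
    refine (key c _ (fun j => ?_) i).1 (hc i)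
    simp only [Fin.is_lt, dif_pos, Fin.eta, Fin.rev_rev]
  · rintro ⟨d, hd⟩
    refine ⟨fun j => (α ^ n) (d (j.rev : ℕ)), fun i => ?_⟩
    refine (key _ d (fun j => ?_) i).2 (hd i)
    rw [RingAut.inv_pow_apply_pow_apply α le_rfl, Nat.sub_self, pow_zero, RingAut.one_apply]

theorem IsColumnRelation.det_twistedHankel_eq_zero {β : RingAut K} {a : ℕ → K} {n : ℕ}
    {c : ℕ → K} (h : IsColumnRelation β a n c) {q : ℕ} (hq : n < q) :
    (twistedHankel β a q).det = 0 := by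
  let w : ℕ → K := fun s => if s < n then c s else if s = n then -1 else 0
  refine Matrix.exists_mulVec_eq_zero_iff.1 ⟨fun s => w s, fun h0 => ?_, ?_⟩
  · simpa [w] using congrFun h0 ⟨n, hq⟩
  · ext r
    simp only [Matrix.mulVec, dotProduct, twistedHankel, Matrix.of_apply, Pi.zero_apply]
    rw [← Finset.sum_range (fun s => (β ^ s) (a (r + s)) * w s),
      ← Finset.sum_subset (Finset.range_subset_range.2 (Nat.succ_le_of_lt hq)),
      Finset.sum_range_succ, h r]
    · have : ∑ x ∈ Finset.range n, (β ^ x) (a (r + x)) * w x =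
          ∑ j ∈ Finset.range n, c j * (β ^ j) (a (r + j)) := by
        refine Finset.sum_congr rfl fun x hx => ?_
        simp [w, Finset.mem_range.1 hx, mul_comm]
      rw [this]
      simp [w]
    · intro x _ hx
      have hx : n + 1 ≤ x := by simpa using hx
      simp [w, show ¬ x < n by omega, show x ≠ n by omega]

theorem exists_isColumnRelation_of_det_twistedHankel {β : RingAut K} {a : ℕ → K} {m : ℕ}
    (hm : (twistedHankel β a m).det ≠ 0)
    (h : ∀ q, m < q → (twistedHankel β a q).det = 0) :
    ∃ c, IsColumnRelation β a m c := by
  obtain ⟨c, hc⟩ : ∃ c : Fin m → K, (twistedHankel β a m).mulVec c =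
      fun r : Fin m => (β ^ m) (a (r + m)) :=
    (Matrix.mulVec_surjective_iff_isUnit.2
      ((Matrix.isUnit_iff_isUnit_det _).2 (isUnit_iff_ne_zero.2 hm))) _
  let d : ℕ → K := fun s => if h : s < m then c ⟨s, h⟩ else 0
  let u : ℕ → K := fun r =>
    (β ^ m) (a (r + m)) - ∑ j ∈ Finset.range m, d j * (β ^ j) (a (r + j))
  have hu_shift (i r : ℕ) : (β ^ i) (u (r + i)) = (β ^ (i + m)) (a (r + (i + m))) -
      ∑ j ∈ Finset.range m, (β ^ i) (d j) * (β ^ (i + j)) (a (r + (i + j))) := by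
    simp only [u, map_sub, map_sum, map_mul, pow_add, RingAut.mul_apply, add_assoc]
  refine ⟨d, fun i => sub_eq_zero.1 (?_ : u i = 0)⟩
  induction i using Nat.strong_induction_on with
  | _ q ih =>
  rcases lt_or_ge q m with hq | hq
  · have := congrFun hc ⟨q, hq⟩
    simp only [Matrix.mulVec, dotProduct, twistedHankel, Matrix.of_apply] at this
    simp only [u]
    rw [sub_eq_zero, ← this, Finset.sum_range]
    refine Finset.sum_congr rfl fun j _ => ?_
    simp [d, mul_comm]
  by_contra hne
  obtain ⟨w, hw0, hw⟩ := Matrix.exists_vecMul_eq_zero_iff.2 (h (q + 1) (by omega))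
  let W : ℕ → K := fun s => if h : s < q + 1 then w ⟨s, h⟩ else 0
  have hWw (r : Fin (q + 1)) : W r = w r := dif_pos r.is_lt
  have hW (s : ℕ) (hs : s ≤ q) :
      ∑ r ∈ Finset.range (q + 1), W r * (β ^ s) (a (r + s)) = 0 := by
    have := congrFun hw ⟨s, by omega⟩
    simp only [Matrix.vecMul, dotProduct, twistedHankel, Matrix.of_apply, Pi.zero_apply] at this
    rw [Finset.sum_range, ← this]
    exact Finset.sum_congr rfl fun r _ => by rw [hWw]
  have hWu (i : ℕ) (hi : i + m ≤ q) :
      ∑ r ∈ Finset.range (q + 1), W r * (β ^ i) (u (r + i)) = 0 := by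
    simp only [hu_shift, mul_sub, Finset.sum_sub_distrib, hW _ hi, zero_sub, neg_eq_zero,
      Finset.mul_sum]
    rw [Finset.sum_comm]
    refine Finset.sum_eq_zero fun j hj => ?_
    have hj := Finset.mem_range.1 hj
    simp only [mul_left_comm (W _)]
    rw [← Finset.mul_sum, hW _ (by omega), mul_zero]
  have hWtop (i : ℕ) (hi : i + m ≤ q) : W (q - i) = 0 := by
    induction i using Nat.strong_induction_on with
    | _ i ihi =>
    have hsum := hWu i hi
    rw [Finset.sum_eq_single_of_mem (q - i) (Finset.mem_range.2 (by omega))] at hsum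
    · rw [Nat.sub_add_cancel (by omega)] at hsum
      exact (mul_eq_zero.1 hsum).resolve_right ((map_ne_zero_iff _ (β ^ i).injective).2 hne)
    · intro r hr hri
      have hr := Finset.mem_range.1 hr
      rcases lt_or_ge (r + i) q with hlt | hge
      · rw [ih _ hlt, map_zero, mul_zero]
      · have := ihi (q - r) (by omega) (by omega)
        rw [Nat.sub_sub_self (by omega)] at this
        rw [this, zero_mul]
  have hWge (r : ℕ) (hr : m ≤ r) (hrq : r ≤ q) : W r = 0 := by
    have := hWtop (q - r) (by omega)
    rwa [Nat.sub_sub_self hrq] at this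
  have hWlt : (fun r : Fin m => W r) = 0 := by
    refine Matrix.eq_zero_of_vecMul_eq_zero hm ?_
    ext s
    simp only [Matrix.vecMul, dotProduct, twistedHankel, Matrix.of_apply, Pi.zero_apply]
    rw [← Finset.sum_range (fun r => W r * (β ^ (s : ℕ)) (a (r + s))), ← hW s (by omega)]
    refine Finset.sum_subset (Finset.range_subset_range.2 (by omega)) fun r hr hrm => ?_
    rw [hWge r (by simpa using hrm) (by simpa [Nat.lt_succ_iff] using hr), zero_mul]
  refine hw0 (funext fun r => ?_)
  rw [← hWw, Pi.zero_apply]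
  rcases lt_or_ge (r : ℕ) m with hlt | hge
  · exact congrFun hWlt ⟨r, hlt⟩
  · exact hWge r hge (by omega)

theorem IsColumnRelation.succ {β : RingAut K} {a : ℕ → K} {m : ℕ} {c : ℕ → K}
    (h : IsColumnRelation β a m c) : ∃ d, IsColumnRelation β a (m + 1) d := by
  refine ⟨fun j => if j = 0 then 0 else β (c (j - 1)), fun i => ?_⟩
  have := congrArg β (h (i + 1))
  rw [map_sum] at this
  rw [Finset.sum_range_succ']
  simpa [pow_succ', add_assoc, add_comm 1] using this

theorem exists_isColumnRelation_iff (β : RingAut K) (a : ℕ → K) :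
    (∃ n, 1 ≤ n ∧ ∃ c, IsColumnRelation β a n c) ↔
      ∃ m, 1 ≤ m ∧ ∀ k, m ≤ k → (twistedHankel β a (k + 1)).det = 0 := by
  constructor
  · rintro ⟨n, hn, c, hc⟩
    exact ⟨n, hn, fun k hk => hc.det_twistedHankel_eq_zero (by omega)⟩
  · rintro ⟨m, -, hm⟩
    classical
    have hex : ∃ p, ∀ q, p < q → (twistedHankel β a q).det = 0 := by
      refine ⟨m, fun q hq => ?_⟩
      obtain ⟨k, rfl⟩ := Nat.exists_eq_add_of_lt hq
      exact hm _ (by omega)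
    have hdet : (twistedHankel β a (Nat.find hex)).det ≠ 0 := by
      intro h0
      rcases Nat.eq_zero_or_pos (Nat.find hex) with hz | hpos
      · rw [hz] at h0
        simp at h0
      · refine Nat.find_min hex (Nat.sub_lt hpos one_pos) fun q hq => ?_
        rcases eq_or_lt_of_le (show Nat.find hex ≤ q by omega) with heq | hlt
        · rwa [← heq]
        · exact Nat.find_spec hex q hlt
    obtain ⟨c, hc⟩ := exists_isColumnRelation_of_det_twistedHankel hdet (Nat.find_spec hex)
    exact ⟨_, Nat.le_add_left 1 _, hc.succ⟩

end

noncomputable section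

/-- Let `K` be a field, `α` a ring automorphism of `K` (with `α^[j]` the
`j`-fold composite), and `(a_i)_{i ≥ 0}` a sequence in `K`.  Then the following are
equivalent:
(i) there are `n ≥ 1` and constants `c_1, …, c_n ∈ K` with
    `a_{i+n} = c_1·α(a_{i+n−1}) + ⋯ + c_n·αⁿ(a_i)` for all `i ≥ 0`;
(ii) there is `m ≥ 1` such that for all `k ≥ m` the `(k+1)×(k+1)` matrix `Δ_k` with
    `(r,s)`-entry `α^{k−s}(a_{r+s})` has determinant zero. -/
theorem statement7 (K : Type*) [Field K] (α : K ≃+* K) (a : ℕ → K) :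
    (∃ n : ℕ, 1 ≤ n ∧ ∃ c : Fin n → K, ∀ i : ℕ,
        a (i + n) = ∑ j : Fin n, c j * (⇑α)^[(j : ℕ) + 1] (a (i + n - ((j : ℕ) + 1)))) ↔
      (∃ m : ℕ, 1 ≤ m ∧ ∀ k : ℕ, m ≤ k →
        (Matrix.of fun r s : Fin (k + 1) =>
          (⇑α)^[k - (s : ℕ)] (a ((r : ℕ) + (s : ℕ)))).det = 0) := by
  simp_rw [det_eq_zero_iff_det_twistedHankel_eq_zero α a,
    exists_recurrence_iff_exists_isColumnRelation α a]
  exact exists_isColumnRelation_iff α⁻¹ a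
end
end
end

section
/- Let k be a field of characteristic zero and let P be a Poisson-prime ideal of O(M_3), i.e. a prime ideal with {P, O(M_3)} ⊆ P. If P contains at least one of the six elements x_{11}, x_{22}, x_{33}, [1̃|1̃] = x_{22}x_{33} − x_{23}x_{32}, [2̃|2̃] = x_{11}x_{33} − x_{13}x_{31}, [3̃|3̃] = x_{11}x_{22} − x_{12}x_{21}, then Det ∈ P. -/
noncomputable section

open MvPolynomial

/-- The coordinate ring `O(M_3)`: the polynomial ring on the variables `x_{ij}`,
`1 ≤ i,j ≤ 3`, indexed here by `Fin 3 × Fin 3` (so `x_{ij} = X (i-1, j-1)`). -/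
abbrev OM3 (k : Type*) [Field k] : Type _ := MvPolynomial (Fin 3 × Fin 3) k

/-- The determinant of the generic `3 × 3` matrix `(x_{ij})`. -/
def det3 (k : Type*) [Field k] : OM3 k :=
  (Matrix.of fun i j : Fin 3 => (X (i, j) : OM3 k)).det

/-- The Leibniz rule in the first argument. -/
theorem PoissonBracket.leibniz_left {k R : Type*} [CommRing k] [CommRing R] [Algebra k R]
    (P : PoissonBracket k R) (a b c : R) :
    P.bracket (a * b) c = P.bracket a c * b + a * P.bracket b c := by
  rw [P.antisymm, P.leibniz, P.antisymm a c, P.antisymm b c]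
  ring

/-- Let `k` be a field of characteristic zero and let `P` be a
Poisson-prime ideal of `O(M_3)` (a prime ideal with `{P, O(M_3)} ⊆ P`, for the standard
Poisson bracket on `O(M_3)`).  If `P` contains one of
`x_{11}, x_{22}, x_{33}, [1̃|1̃], [2̃|2̃], [3̃|3̃]`, then `Det ∈ P`. -/
theorem statement9
    (k : Type*) [Field k] [CharZero k]
    (P : PoissonBracket k (OM3 k))
    (hProw : ∀ i j m : Fin 3, j < m →
      P.bracket (X (i, j)) (X (i, m)) = X (i, j) * X (i, m))
    (hPcol : ∀ i l j : Fin 3, i < l →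
      P.bracket (X (i, j)) (X (l, j)) = X (i, j) * X (l, j))
    (hPanti : ∀ i l j m : Fin 3, i < l → j < m →
      P.bracket (X (i, m)) (X (l, j)) = 0)
    (hPdiag : ∀ i l j m : Fin 3, i < l → j < m →
      P.bracket (X (i, j)) (X (l, m)) = 2 * (X (i, m) * X (l, j)))
    (I : Ideal (OM3 k)) (hprime : I.IsPrime)
    (hPoisson : ∀ a ∈ I, ∀ b : OM3 k, P.bracket a b ∈ I)
    (hmem :
      X ((0 : Fin 3), (0 : Fin 3)) ∈ I ∨
      X ((1 : Fin 3), (1 : Fin 3)) ∈ I ∨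
      X ((2 : Fin 3), (2 : Fin 3)) ∈ I ∨
      (X ((1 : Fin 3), (1 : Fin 3)) * X (2, 2) - X (1, 2) * X (2, 1) : OM3 k) ∈ I ∨
      (X ((0 : Fin 3), (0 : Fin 3)) * X (2, 2) - X (0, 2) * X (2, 0) : OM3 k) ∈ I ∨
      (X ((0 : Fin 3), (0 : Fin 3)) * X (1, 1) - X (0, 1) * X (1, 0) : OM3 k) ∈ I) :
    det3 k ∈ I := by
  have htwo : (2 : OM3 k ⧸ I) ≠ 0 := by
    rw [Ne, ← map_ofNat (Ideal.Quotient.mk I), Ideal.Quotient.eq_zero_iff_mem]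
    intro h
    apply hprime.ne_top
    apply I.eq_top_of_isUnit_mem h
    have hu : IsUnit (C (2 : k) : OM3 k) := (IsUnit.mk0 (2 : k) two_ne_zero).map C
    rwa [map_ofNat] at hu
  have hdet : det3 k =
      X (0, 0) * (X (1, 1) * X (2, 2) - X (1, 2) * X (2, 1))
        - X (0, 1) * (X (1, 0) * X (2, 2) - X (1, 2) * X (2, 0))
        + X (0, 2) * (X (1, 0) * X (2, 1) - X (1, 1) * X (2, 0)) := by
    simp only [det3, Matrix.det_fin_three, Matrix.of_apply]
    ring
  rw [hdet, ← Ideal.Quotient.eq_zero_iff_mem]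
  simp only [← Ideal.Quotient.eq_zero_iff_mem] at hmem
  have hbr : ∀ a b : OM3 k, Ideal.Quotient.mk I a = 0 →
      Ideal.Quotient.mk I (P.bracket a b) = 0 := fun a b h =>
    Ideal.Quotient.eq_zero_iff_mem.mpr (hPoisson a (Ideal.Quotient.eq_zero_iff_mem.mp h) b)
  have hbr' : ∀ a b : OM3 k, Ideal.Quotient.mk I a = 0 →
      Ideal.Quotient.mk I (P.bracket b a) = 0 := fun a b h => by
    rw [P.antisymm, map_neg, hbr a b h, neg_zero]
  have hdiag : ∀ i l j m : Fin 3, i < l → j < m →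
      (Ideal.Quotient.mk I (X (i, j)) = 0 ∨ Ideal.Quotient.mk I (X (l, m)) = 0) →
      Ideal.Quotient.mk I (X (i, m)) = 0 ∨ Ideal.Quotient.mk I (X (l, j)) = 0 := by
    intro i l j m hil hjm h
    have h0 := h.elim (hbr _ (X (l, m))) (hbr' _ (X (i, j)))
    rw [hPdiag i l j m hil hjm, map_mul, map_mul, map_ofNat] at h0
    exact mul_eq_zero.mp ((mul_eq_zero.mp h0).resolve_left htwo)
  simp only [map_add, map_sub, map_mul] at hmem ⊢
  by_contra hD
  have hx11 : Ideal.Quotient.mk I (X (0, 0)) ≠ 0 := fun h => by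
    have h1 := hdiag 0 1 0 1 (by decide) (by decide) (.inl h)
    have h2 := hdiag 0 1 0 2 (by decide) (by decide) (.inl h)
    have h3 := hdiag 0 2 0 1 (by decide) (by decide) (.inl h)
    have h4 := hdiag 0 2 0 2 (by decide) (by decide) (.inl h)
    grind
  have hx33 : Ideal.Quotient.mk I (X (2, 2)) ≠ 0 := fun h => by
    have h1 := hdiag 0 2 0 2 (by decide) (by decide) (.inr h)
    have h2 := hdiag 0 2 1 2 (by decide) (by decide) (.inr h)
    have h3 := hdiag 1 2 0 2 (by decide) (by decide) (.inr h)
    have h4 := hdiag 1 2 1 2 (by decide) (by decide) (.inr h)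
    grind
  rcases hmem with h | h | h | h | h | h
  · exact hx11 h
  · have h1 := hdiag 0 1 0 1 (by decide) (by decide) (.inr h)
    have h2 := hdiag 1 2 1 2 (by decide) (by decide) (.inl h)
    have h3 h := hdiag 0 2 1 2 (by decide) (by decide) (.inl h)
    have h4 h := hdiag 1 2 0 2 (by decide) (by decide) (.inl h)
    grind
  · exact hx33 h
  · simp only [← map_mul, ← map_sub] at h
    have hb := hbr' _ (X (0, 0)) h
    rw [map_sub, P.leibniz, P.leibniz, hPdiag 0 1 0 1 (by decide) (by decide),
      hPdiag 0 2 0 2 (by decide) (by decide), hPdiag 0 1 0 2 (by decide) (by decide),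
      hPdiag 0 2 0 1 (by decide) (by decide)] at hb
    simp only [map_add, map_sub, map_mul, map_ofNat] at h hb
    refine hD ((mul_eq_zero.mp ?_).resolve_left htwo)
    linear_combination 2 * Ideal.Quotient.mk I (X (0, 0)) * h - hb
  · simp only [← map_mul, ← map_sub] at h
    have hb := hbr _ (X (0, 1)) h
    rw [map_sub, LinearMap.sub_apply, P.leibniz_left, P.leibniz_left,
      hProw 0 0 1 (by decide), P.antisymm (X (2, 2)), hPdiag 0 2 1 2 (by decide) (by decide),
      P.antisymm (X (0, 2)), hProw 0 1 2 (by decide), P.antisymm (X (2, 0)),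
      hPanti 0 2 0 1 (by decide) (by decide)] at hb
    simp only [map_add, map_sub, map_mul, map_neg, map_zero, map_ofNat] at h hb
    have hm : Ideal.Quotient.mk I (X (0, 1)) * Ideal.Quotient.mk I (X (2, 2))
        - Ideal.Quotient.mk I (X (0, 2)) * Ideal.Quotient.mk I (X (2, 1)) = 0 := by
      refine (mul_eq_zero.mp ((mul_eq_zero.mp ?_).resolve_left htwo)).resolve_left hx11
      linear_combination hb + Ideal.Quotient.mk I (X (0, 1)) * h
    refine hD ((mul_eq_zero.mp ?_).resolve_left hx33)
    linear_combination (Ideal.Quotient.mk I (X (1, 1)) * Ideal.Quotient.mk I (X (2, 2))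
        - Ideal.Quotient.mk I (X (1, 2)) * Ideal.Quotient.mk I (X (2, 1))) * h
      - (Ideal.Quotient.mk I (X (1, 0)) * Ideal.Quotient.mk I (X (2, 2))
        - Ideal.Quotient.mk I (X (1, 2)) * Ideal.Quotient.mk I (X (2, 0))) * hm
  · simp only [← map_mul, ← map_sub] at h
    have hb := hbr _ (X (2, 2)) h
    rw [map_sub, LinearMap.sub_apply, P.leibniz_left, P.leibniz_left,
      hPdiag 0 2 0 2 (by decide) (by decide), hPdiag 1 2 1 2 (by decide) (by decide),
      hPdiag 0 2 1 2 (by decide) (by decide), hPdiag 1 2 0 2 (by decide) (by decide)] at hb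
    simp only [map_add, map_sub, map_mul, map_ofNat] at h hb
    refine hD ((mul_eq_zero.mp ?_).resolve_left htwo)
    linear_combination 2 * Ideal.Quotient.mk I (X (2, 2)) * h - hb
end
end

section
/- Let k be a field of characteristic zero. The minors [3̃|1̃] = x_{12}x_{23} − x_{13}x_{22} and [1̃|3̃] = x_{21}x_{32} − x_{22}x_{31} are Poisson normal in O(M_3): for every f ∈ O(M_3), {f, [3̃|1̃]} lies in the principal ideal generated by [3̃|1̃], and {f, [1̃|3̃]} lies in the principal ideal generated by [1̃|3̃]. -/
noncomputable section

open MvPolynomial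

/-- The minor `[3̃|1̃] = x_{12}x_{23} − x_{13}x_{22}` (delete row 3, column 1). -/
def minor31 (k : Type*) [Field k] : OM3 k :=
  X ((0 : Fin 3), (1 : Fin 3)) * X (1, 2) - X (0, 2) * X (1, 1)

/-- The minor `[1̃|3̃] = x_{21}x_{32} − x_{22}x_{31}` (delete row 1, column 3). -/
def minor13 (k : Type*) [Field k] : OM3 k :=
  X ((1 : Fin 3), (0 : Fin 3)) * X (2, 1) - X (1, 1) * X (2, 0)

namespace PoissonBracket

variable {k R : Type*} [CommRing k] [CommRing R] [Algebra k R] (P : PoissonBracket k R)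

lemma mul_left (a b c : R) : P.bracket (a * b) c = P.bracket a c * b + a * P.bracket b c := by
  rw [P.antisymm, P.leibniz, P.antisymm c a, P.antisymm c b]
  ring

lemma one_left (c : R) : P.bracket 1 c = 0 := by
  simpa using P.mul_left 1 1 c

lemma self_eq_zero [IsDomain R] [CharZero R] (a : R) : P.bracket a a = 0 :=
  self_eq_neg.mp (P.antisymm a a)

/-- Poisson normality with respect to an ideal can be checked on polynomial generators. -/
lemma mem_of_forall_X {σ : Type*} (P : PoissonBracket k (MvPolynomial σ k))
    {I : Ideal (MvPolynomial σ k)} {d : MvPolynomial σ k}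
    (h : ∀ s, P.bracket (X s) d ∈ I) (f : MvPolynomial σ k) : P.bracket f d ∈ I := by
  induction f using MvPolynomial.induction_on with
  | C a =>
    rw [← mul_one (C a), ← MvPolynomial.smul_eq_C_mul, map_smul, LinearMap.smul_apply,
      P.one_left, smul_zero]
    exact I.zero_mem
  | add p q hp hq =>
    rw [map_add, LinearMap.add_apply]
    exact I.add_mem hp hq
  | mul_X p s hp =>
    rw [P.mul_left]
    exact I.add_mem (I.mul_mem_right _ hp) (I.mul_mem_left _ (h s))

end PoissonBracket

/-- Let `k` be a field of characteristic zero.  In `O(M_3)` with the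
standard Poisson bracket, the minors `[3̃|1̃] = x_{12}x_{23} − x_{13}x_{22}` and
`[1̃|3̃] = x_{21}x_{32} − x_{22}x_{31}` are Poisson normal: for every `f ∈ O(M_3)`,
`{f, [3̃|1̃]}` lies in the principal ideal generated by `[3̃|1̃]`, and `{f, [1̃|3̃]}` lies in
the principal ideal generated by `[1̃|3̃]`. -/
theorem statement11
    (k : Type*) [Field k] [CharZero k]
    (P : PoissonBracket k (OM3 k))
    (hProw : ∀ i j m : Fin 3, j < m →
      P.bracket (X (i, j)) (X (i, m)) = X (i, j) * X (i, m))
    (hPcol : ∀ i l j : Fin 3, i < l →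
      P.bracket (X (i, j)) (X (l, j)) = X (i, j) * X (l, j))
    (hPanti : ∀ i l j m : Fin 3, i < l → j < m →
      P.bracket (X (i, m)) (X (l, j)) = 0)
    (hPdiag : ∀ i l j m : Fin 3, i < l → j < m →
      P.bracket (X (i, j)) (X (l, m)) = 2 * (X (i, m) * X (l, j))) :
    ∀ f : OM3 k,
      P.bracket f (minor31 k) ∈ Ideal.span {minor31 k} ∧
      P.bracket f (minor13 k) ∈ Ideal.span {minor13 k} := by
  have hself : ∀ p, P.bracket (X p) (X p) = 0 := fun p => P.self_eq_zero _
  have hrow : ∀ i j m : Fin 3, j < m →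
      P.bracket (X (i, m)) (X (i, j)) = -(X (i, j) * X (i, m)) := fun i j m h => by
    rw [P.antisymm, hProw i j m h]
  have hcol : ∀ i l j : Fin 3, i < l →
      P.bracket (X (l, j)) (X (i, j)) = -(X (i, j) * X (l, j)) := fun i l j h => by
    rw [P.antisymm, hPcol i l j h]
  have hanti : ∀ i l j m : Fin 3, i < l → j < m →
      P.bracket (X (l, j)) (X (i, m)) = 0 := fun i l j m h h' => by
    rw [P.antisymm, hPanti i l j m h h', neg_zero]
  have hdiag : ∀ i l j m : Fin 3, i < l → j < m →
      P.bracket (X (l, m)) (X (i, j)) = -(2 * (X (i, m) * X (l, j))) := fun i l j m h h' => by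
    rw [P.antisymm, hPdiag i l j m h h']
  intro f
  constructor
  · refine P.mem_of_forall_X (fun ⟨i, j⟩ => Ideal.mem_span_singleton'.mpr
      ⟨((if j = 0 then 1 else 0) - (if i = 2 then 1 else 0)) * X (i, j), ?_⟩) f
    fin_cases i <;> fin_cases j <;>
      simp (discharger := decide) [minor31, P.leibniz, hself, hProw, hPcol, hPanti, hPdiag,
        hrow, hcol, hanti, hdiag] <;> ring
  · refine P.mem_of_forall_X (fun ⟨i, j⟩ => Ideal.mem_span_singleton'.mpr
      ⟨((if i = 0 then 1 else 0) - (if j = 2 then 1 else 0)) * X (i, j), ?_⟩) f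
    fin_cases i <;> fin_cases j <;>
      simp (discharger := decide) [minor13, P.leibniz, hself, hProw, hPcol, hPanti, hPdiag,
        hrow, hcol, hanti, hdiag] <;> ring
end
end

section
/- Let k be a field of characteristic zero and let P be a prime ideal of O(M_3) which is closed under the Poisson bracket ({P, O(M_3)} ⊆ P) and which does not contain Det. If x_{12} ∈ P or x_{23} ∈ P, then x_{13} ∈ P; and if x_{21} ∈ P or x_{32} ∈ P, then x_{31} ∈ P. -/
noncomputable section

open MvPolynomial

/-- Let `k` be a field of characteristic zero and let `I` be a prime ideal
of `O(M_3)` closed under the standard Poisson bracket and not containing `Det`.  If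
`x_{12} ∈ I` or `x_{23} ∈ I`, then `x_{13} ∈ I`; and if `x_{21} ∈ I` or `x_{32} ∈ I`, then
`x_{31} ∈ I`. -/
theorem statement12
    (k : Type*) [Field k] [CharZero k]
    (P : PoissonBracket k (OM3 k))
    (hProw : ∀ i j m : Fin 3, j < m →
      P.bracket (X (i, j)) (X (i, m)) = X (i, j) * X (i, m))
    (hPcol : ∀ i l j : Fin 3, i < l →
      P.bracket (X (i, j)) (X (l, j)) = X (i, j) * X (l, j))
    (hPanti : ∀ i l j m : Fin 3, i < l → j < m →
      P.bracket (X (i, m)) (X (l, j)) = 0)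
    (hPdiag : ∀ i l j m : Fin 3, i < l → j < m →
      P.bracket (X (i, j)) (X (l, m)) = 2 * (X (i, m) * X (l, j)))
    (I : Ideal (OM3 k)) (hprime : I.IsPrime)
    (hPoisson : ∀ a ∈ I, ∀ b : OM3 k, P.bracket a b ∈ I)
    (hDet : det3 k ∉ I) :
    ((X ((0 : Fin 3), (1 : Fin 3)) ∈ I ∨ X ((1 : Fin 3), (2 : Fin 3)) ∈ I) →
        X ((0 : Fin 3), (2 : Fin 3)) ∈ I) ∧
    ((X ((1 : Fin 3), (0 : Fin 3)) ∈ I ∨ X ((2 : Fin 3), (1 : Fin 3)) ∈ I) →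
        X ((2 : Fin 3), (0 : Fin 3)) ∈ I) := by
  have corner_mem {i l j m : Fin 3} (hil : i < l) (hjm : j < m)
      (h : X (i, j) ∈ I ∨ X (l, m) ∈ I) : X (i, m) ∈ I ∨ X (l, j) ∈ I := by
    have hbracket : P.bracket (X (i, j)) (X (l, m)) ∈ I := by
      rcases h with h | h
      · exact hPoisson _ h _
      · rw [P.antisymm]
        exact I.neg_mem (hPoisson _ h _)
    rw [hPdiag i l j m hil hjm] at hbracket
    have two_unit : IsUnit (2 : OM3 k) := by
      rw [← map_ofNat (C : k →+* OM3 k) 2]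
      exact (IsUnit.mk0 (2 : k) two_ne_zero).map C
    exact hprime.mem_or_mem ((Ideal.unit_mul_mem_iff_mem I two_unit).mp hbracket)
  have not_row (h₀ : X ((1 : Fin 3), (0 : Fin 3)) ∈ I) (h₁ : X ((1 : Fin 3), (1 : Fin 3)) ∈ I)
      (h₂ : X ((1 : Fin 3), (2 : Fin 3)) ∈ I) : False := by
    apply hDet
    rw [← Ideal.Quotient.eq_zero_iff_mem] at *
    simp [det3, Matrix.det_fin_three, h₀, h₁, h₂]
  have not_col (h₀ : X ((0 : Fin 3), (1 : Fin 3)) ∈ I) (h₁ : X ((1 : Fin 3), (1 : Fin 3)) ∈ I)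
      (h₂ : X ((2 : Fin 3), (1 : Fin 3)) ∈ I) : False := by
    apply hDet
    rw [← Ideal.Quotient.eq_zero_iff_mem] at *
    simp [det3, Matrix.det_fin_three, h₀, h₁, h₂]
  refine ⟨fun h => ?_, fun h => ?_⟩ <;> by_contra hcorner
  · have h₁₁ := (corner_mem (i := 0) (l := 1) (j := 1) (m := 2) (by decide) (by decide)
      h).resolve_left hcorner
    rcases h with h | h
    · exact not_col h h₁₁ ((corner_mem (i := 0) (l := 2) (j := 1) (m := 2) (by decide) (by decide)
        (.inl h)).resolve_left hcorner)
    · exact not_row ((corner_mem (i := 0) (l := 1) (j := 0) (m := 2) (by decide) (by decide)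
        (.inr h)).resolve_left hcorner) h₁₁ h
  · have h₁₁ := (corner_mem (i := 1) (l := 2) (j := 0) (m := 1) (by decide) (by decide)
      h).resolve_right hcorner
    rcases h with h | h
    · exact not_row h h₁₁ ((corner_mem (i := 1) (l := 2) (j := 0) (m := 2) (by decide) (by decide)
        (.inl h)).resolve_right hcorner)
    · exact not_col ((corner_mem (i := 0) (l := 2) (j := 0) (m := 1) (by decide) (by decide)
        (.inr h)).resolve_right hcorner) h₁₁ h
end
end
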